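/- (Interaction Morawetz estimate for the free Schrödinger equation) Let d ≥ 4 and write x = (y, z) ∈ ℝ³ × ℝ^{d−3}. There is an absolute constant C > 0 such that for every T > 0 and every smooth solution u : [0,T] × ℝ^d → ℂ of the free Schrödinger equation i ∂_t u + Δ u = 0 that is Schwartz in x uniformly in t: ∫_0^T ∫_{ℝ³} ( ∫_{ℝ^{d−3}} |u(t, y, z)|² dz )² dy dt ≤ C · sup_{0≤t≤T} ‖u(t)‖²_{L²(ℝ^d)} · sup_{0≤t≤T} ∫_{ℝ^d} |u(t,x)| |∇_y u(t,x)| dx. -/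

import Mathlib

open MeasureTheory

noncomputable section

/-- `u` solves the free Schrödinger equation `i ∂ₜ u + Δ u = 0` on `[0,T] × ℝ^d`,
where `ℝ^d` is modelled as `ℝ³ × ℝ^{d-3}` (`d = k + 3`, `x = (y, z)`). -/
def isFreeSchrodingerYZ (k : ℕ) (T : ℝ)
    (u : ℝ → EuclideanSpace ℝ (Fin 3) → EuclideanSpace ℝ (Fin k) → ℂ) : Prop :=
  ∀ t ∈ Set.Icc (0 : ℝ) T,
    ∀ (y : EuclideanSpace ℝ (Fin 3)) (z : EuclideanSpace ℝ (Fin k)),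
      Complex.I * deriv (fun s => u s y z) t
        + ∑ i : Fin 3,
            fderiv ℝ (fun y' => fderiv ℝ (fun y'' => u t y'' z) y'
              (EuclideanSpace.single i 1)) y (EuclideanSpace.single i 1)
        + ∑ j : Fin k,
            fderiv ℝ (fun z' => fderiv ℝ (fun z'' => u t y z'') z'
              (EuclideanSpace.single j 1)) z (EuclideanSpace.single j 1)
        = 0

/-- `u` is smooth on `[0,T] × ℝ^d` and Schwartz in `x = (y,z)` uniformly in `t`. -/
def smoothUniformSchwartzYZ (k : ℕ) (T : ℝ)
    (u : ℝ → EuclideanSpace ℝ (Fin 3) → EuclideanSpace ℝ (Fin k) → ℂ) : Prop :=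
  ContDiffOn ℝ (⊤ : ℕ∞)
    (fun p : ℝ × EuclideanSpace ℝ (Fin 3) × EuclideanSpace ℝ (Fin k) =>
      u p.1 p.2.1 p.2.2)
    (Set.Icc (0 : ℝ) T ×ˢ Set.univ) ∧
  ∀ n m : ℕ, ∃ C : ℝ, ∀ t ∈ Set.Icc (0 : ℝ) T,
    ∀ (y : EuclideanSpace ℝ (Fin 3)) (z : EuclideanSpace ℝ (Fin k)),
      (1 + ‖y‖ + ‖z‖) ^ n *
        ‖iteratedFDeriv ℝ m
          (fun q : EuclideanSpace ℝ (Fin 3) × EuclideanSpace ℝ (Fin k) =>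
            u t q.1 q.2) (y, z)‖ ≤ C

open scoped BoundedContinuousFunction

/-- A family of functions `f t`, `t ∈ S`, that is Schwartz uniformly in `t`. -/
def UniformlySchwartz {V : Type*} [NormedAddCommGroup V] [NormedSpace ℝ V] (S : Set ℝ)
    (f : ℝ → V → ℂ) : Prop :=
  (∀ t ∈ S, ContDiff ℝ (⊤ : ℕ∞) (f t)) ∧
    ∀ n m : ℕ, ∃ C : ℝ, ∀ t ∈ S, ∀ x, (1 + ‖x‖) ^ n * ‖iteratedFDeriv ℝ m (f t) x‖ ≤ C

namespace UniformlySchwartz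

section Basic

variable {V : Type*} [NormedAddCommGroup V] [NormedSpace ℝ V] {S : Set ℝ} {f g : ℝ → V → ℂ}

theorem mono {S' : Set ℝ} (hf : UniformlySchwartz S f) (h : S' ⊆ S) : UniformlySchwartz S' f :=
  ⟨fun t ht => hf.1 t (h ht), fun n m => (hf.2 n m).imp fun _ hC t ht => hC t (h ht)⟩

theorem continuous (hf : UniformlySchwartz S f) {t : ℝ} (ht : t ∈ S) : Continuous (f t) :=
  (hf.1 t ht).continuous

theorem differentiable (hf : UniformlySchwartz S f) {t : ℝ} (ht : t ∈ S) :
    Differentiable ℝ (f t) :=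
  (hf.1 t ht).differentiable (by simp)

theorem fderiv_apply (hf : UniformlySchwartz S f) (e : V) :
    UniformlySchwartz S (fun t x => fderiv ℝ (f t) x e) := by
  have hd : ∀ t ∈ S, ContDiff ℝ (⊤ : ℕ∞) (fderiv ℝ (f t)) := fun t ht =>
    (hf.1 t ht).fderiv_right (by simp)
  refine ⟨fun t ht => (hd t ht).clm_apply contDiff_const, fun n m => ?_⟩
  obtain ⟨C, hC⟩ := hf.2 n (m + 1)
  refine ⟨‖e‖ * C, fun t ht x => ?_⟩
  have h := norm_iteratedFDeriv_clm_apply_const (c := e) (x := x) (n := m)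
    (hd t ht).contDiffAt (by exact_mod_cast le_top)
  rw [norm_iteratedFDeriv_fderiv] at h
  calc _ ≤ (1 + ‖x‖) ^ n * (‖e‖ * ‖iteratedFDeriv ℝ (m + 1) (f t) x‖) := by gcongr
    _ = ‖e‖ * ((1 + ‖x‖) ^ n * ‖iteratedFDeriv ℝ (m + 1) (f t) x‖) := by ring
    _ ≤ _ := by gcongr; exact hC t ht x

theorem sum {ι : Type*} (s : Finset ι) {F : ι → ℝ → V → ℂ}
    (hF : ∀ i ∈ s, UniformlySchwartz S (F i)) :
    UniformlySchwartz S (fun t x => ∑ i ∈ s, F i t x) := by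
  refine ⟨fun t ht => ContDiff.sum fun i hi => (hF i hi).1 t ht, fun n m => ?_⟩
  choose! C hC using fun i (hi : i ∈ s) => (hF i hi).2 n m
  refine ⟨∑ i ∈ s, C i, fun t ht x => ?_⟩
  have h := iteratedFDeriv_fun_sum_apply (𝕜 := ℝ) (f := fun i => F i t) (u := s) (n := m) (x := x)
    (fun i hi => ((hF i hi).1 t ht).contDiffAt.of_le (by exact_mod_cast le_top))
  rw [h]
  calc _ ≤ (1 + ‖x‖) ^ n * ∑ i ∈ s, ‖iteratedFDeriv ℝ m (F i t) x‖ := by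
        gcongr; exact norm_sum_le _ _
    _ = ∑ i ∈ s, (1 + ‖x‖) ^ n * ‖iteratedFDeriv ℝ m (F i t) x‖ := Finset.mul_sum _ _ _
    _ ≤ _ := Finset.sum_le_sum fun i hi => hC i hi t ht x

theorem exists_norm_le (hf : UniformlySchwartz S f) (n : ℕ) :
    ∃ C : ℝ, 0 ≤ C ∧ ∀ t ∈ S, ∀ x, ‖f t x‖ ≤ C * (1 + ‖x‖) ^ (-(n : ℝ)) := by
  obtain ⟨C, hC⟩ := hf.2 n 0
  refine ⟨max C 0, le_max_right _ _, fun t ht x => ?_⟩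
  have h := hC t ht x
  rw [norm_iteratedFDeriv_zero] at h
  have h1 : (0 : ℝ) < 1 + ‖x‖ := by positivity
  rw [Real.rpow_neg h1.le, Real.rpow_natCast, ← div_eq_mul_inv, le_div_iff₀ (by positivity),
    mul_comm]
  exact h.trans (le_max_left _ _)

theorem exists_norm_mul_norm_le (hf : UniformlySchwartz S f) (hg : UniformlySchwartz S g) (n : ℕ) :
    ∃ C : ℝ, 0 ≤ C ∧ ∀ t ∈ S, ∀ x, ‖f t x‖ * ‖g t x‖ ≤ C * (1 + ‖x‖) ^ (-(n : ℝ)) := by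
  obtain ⟨C, hC0, hC⟩ := hf.exists_norm_le n
  obtain ⟨C', hC0', hC'⟩ := hg.exists_norm_le 0
  refine ⟨C * C', by positivity, fun t ht x => ?_⟩
  have h' : ‖g t x‖ ≤ C' := by simpa using hC' t ht x
  calc _ ≤ (C * (1 + ‖x‖) ^ (-(n : ℝ))) * C' := by gcongr; exact hC t ht x
    _ = _ := by ring

end Basic

theorem tensor {E F : Type*} [NormedAddCommGroup E] [NormedSpace ℝ E] [NormedAddCommGroup F]
    [NormedSpace ℝ F] {S : Set ℝ} {f : ℝ → E → ℂ} {g : ℝ → F → ℂ} (hf : UniformlySchwartz S f)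
    (hg : UniformlySchwartz S g) :
    UniformlySchwartz S (fun t (p : E × F) => f t p.1 * g t p.2) := by
  have hfst : ∀ t ∈ S, ContDiff ℝ (⊤ : ℕ∞) (fun p : E × F => f t p.1) := fun t ht =>
    (hf.1 t ht).comp contDiff_fst
  have hsnd : ∀ t ∈ S, ContDiff ℝ (⊤ : ℕ∞) (fun p : E × F => g t p.2) := fun t ht =>
    (hg.1 t ht).comp contDiff_snd
  refine ⟨fun t ht => (hfst t ht).mul (hsnd t ht), fun n m => ?_⟩
  choose A hA using fun i => hf.2 n i
  choose B hB using fun i => hg.2 n i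
  refine ⟨∑ i ∈ Finset.range (m + 1), (m.choose i : ℝ) * (|A i| * |B (m - i)|),
    fun t ht p => ?_⟩
  have h1 : ∀ i, ‖iteratedFDeriv ℝ i (fun p : E × F => f t p.1) p‖ ≤
      ‖iteratedFDeriv ℝ i (f t) p.1‖ := fun i => by
    have := (ContinuousLinearMap.fst ℝ E F).iteratedFDeriv_comp_right (hf.1 t ht) p (i := i)
      (by exact_mod_cast le_top)
    change iteratedFDeriv ℝ i (fun p : E × F => f t p.1) p = _ at this
    rw [this]
    refine (ContinuousMultilinearMap.norm_compContinuousLinearMap_le _ _).trans ?_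
    refine mul_le_of_le_one_right (norm_nonneg _) (Finset.prod_le_one (fun _ _ => norm_nonneg _)
      fun _ _ => ContinuousLinearMap.norm_fst_le ..)
  have h2 : ∀ i, ‖iteratedFDeriv ℝ i (fun p : E × F => g t p.2) p‖ ≤
      ‖iteratedFDeriv ℝ i (g t) p.2‖ := fun i => by
    have := (ContinuousLinearMap.snd ℝ E F).iteratedFDeriv_comp_right (hg.1 t ht) p (i := i)
      (by exact_mod_cast le_top)
    change iteratedFDeriv ℝ i (fun p : E × F => g t p.2) p = _ at this
    rw [this]
    refine (ContinuousMultilinearMap.norm_compContinuousLinearMap_le _ _).trans ?_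
    refine mul_le_of_le_one_right (norm_nonneg _) (Finset.prod_le_one (fun _ _ => norm_nonneg _)
      fun _ _ => ContinuousLinearMap.norm_snd_le ..)
  have hp : (1 + ‖p‖) ^ n ≤ (1 + ‖p.1‖) ^ n * (1 + ‖p.2‖) ^ n := by
    rw [← mul_pow]
    have : ‖p‖ ≤ ‖p.1‖ + ‖p.2‖ :=
      max_le (le_add_of_nonneg_right (norm_nonneg _)) (le_add_of_nonneg_left (norm_nonneg _))
    gcongr
    nlinarith [norm_nonneg p.1, norm_nonneg p.2]
  refine (mul_le_mul_of_nonneg_left (norm_iteratedFDeriv_mul_le (hfst t ht) (hsnd t ht) p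
    (n := m) (by exact_mod_cast le_top)) (by positivity)).trans ?_
  rw [Finset.mul_sum]
  refine Finset.sum_le_sum fun i _ => ?_
  have hA' := (hA i t ht p.1).trans (le_abs_self _)
  have hB' := (hB (m - i) t ht p.2).trans (le_abs_self _)
  calc _ ≤ ((1 + ‖p.1‖) ^ n * (1 + ‖p.2‖) ^ n) * ((m.choose i : ℝ) *
        ‖iteratedFDeriv ℝ i (f t) p.1‖ * ‖iteratedFDeriv ℝ (m - i) (g t) p.2‖) := by
        gcongr
        exacts [h1 i, h2 _]
    _ = (m.choose i : ℝ) * (((1 + ‖p.1‖) ^ n * ‖iteratedFDeriv ℝ i (f t) p.1‖) *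
        ((1 + ‖p.2‖) ^ n * ‖iteratedFDeriv ℝ (m - i) (g t) p.2‖)) := by ring
    _ ≤ _ := by gcongr

section Integral

variable {V : Type*} [NormedAddCommGroup V] [NormedSpace ℝ V] [FiniteDimensional ℝ V]
  [MeasurableSpace V] [BorelSpace V] {μ : Measure V} [μ.IsAddHaarMeasure]
  {S : Set ℝ} {f g : ℝ → V → ℂ}

theorem integrable_norm_mul_norm (hf : UniformlySchwartz S f) (hg : UniformlySchwartz S g)
    {t : ℝ} (ht : t ∈ S) : Integrable (fun x => ‖f t x‖ * ‖g t x‖) μ := by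
  obtain ⟨C, -, hC⟩ := hf.exists_norm_mul_norm_le hg (Module.finrank ℝ V + 1)
  refine ((integrable_one_add_norm (μ := μ) (E := V) (r := (Module.finrank ℝ V + 1 : ℕ))
    (by push_cast; linarith)).const_mul C).mono'
    ((hf.continuous ht).norm.mul (hg.continuous ht).norm).aestronglyMeasurable
    (.of_forall fun x => ?_)
  rw [Real.norm_of_nonneg (by positivity)]
  exact hC t ht x

theorem integrable_mul_inner (hf : UniformlySchwartz S f) (hg : UniformlySchwartz S g)
    {t : ℝ} (ht : t ∈ S) (b : V →ᵇ ℝ) :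
    Integrable (fun x => b x * inner ℝ (f t x) (g t x)) μ := by
  refine ((hf.integrable_norm_mul_norm (μ := μ) hg ht).const_mul ‖b‖).mono'
    (b.continuous.mul ((hf.continuous ht).inner (hg.continuous ht))).aestronglyMeasurable
    (.of_forall fun x => ?_)
  rw [norm_mul]
  exact mul_le_mul (b.norm_coe_le_norm x) (norm_inner_le_norm _ _) (norm_nonneg _) (norm_nonneg _)

theorem integral_by_parts (hf : UniformlySchwartz S f) (hg : UniformlySchwartz S g)
    {t : ℝ} (ht : t ∈ S) {b b' : V →ᵇ ℝ} (e : V) (hb : Differentiable ℝ b)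
    (hbe : ∀ x, fderiv ℝ b x e = b' x) :
    ∫ x, b x * inner ℝ (f t x) (fderiv ℝ (g t) x e) ∂μ =
      -(∫ x, b' x * inner ℝ (f t x) (g t x) ∂μ) -
        ∫ x, b x * inner ℝ (fderiv ℝ (f t) x e) (g t x) ∂μ := by
  have hF : Differentiable ℝ (fun x => inner ℝ (f t x) (g t x)) :=
    (hf.differentiable ht).inner ℝ (hg.differentiable ht)
  have hdF : ∀ x, fderiv ℝ (fun x => inner ℝ (f t x) (g t x)) x e =
      inner ℝ (f t x) (fderiv ℝ (g t) x e) + inner ℝ (fderiv ℝ (f t) x e) (g t x) := fun x =>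
    fderiv_inner_apply ℝ (hf.differentiable ht x) (hg.differentiable ht x) e
  have i2 := hf.integrable_mul_inner (μ := μ) (hg.fderiv_apply e) ht b
  have i3 := (hf.fderiv_apply e).integrable_mul_inner (μ := μ) hg ht b
  have key := integral_mul_fderiv_eq_neg_fderiv_mul_of_integrable (μ := μ) (f := b)
    (g := fun x => inner ℝ (f t x) (g t x)) (v := e)
    (by simpa only [hbe] using hf.integrable_mul_inner (μ := μ) hg ht b')
    (by simp only [hdF, mul_add]; exact i2.add i3)
    (hf.integrable_mul_inner hg ht b) (fun x _ => hb x) (fun x _ => hF x)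
  simp only [hdF, hbe, mul_add] at key
  rw [integral_add i2 i3] at key
  linarith

end Integral

end UniformlySchwartz

theorem fderiv_fderiv_apply_comm {V : Type*} [NormedAddCommGroup V] [NormedSpace ℝ V] {f : V → ℂ}
    {x : V} (hf : ContDiffAt ℝ 2 f x) (v w : V) :
    fderiv ℝ (fun y => fderiv ℝ f y v) x w = fderiv ℝ (fun y => fderiv ℝ f y w) x v := by
  have hd : DifferentiableAt ℝ (fderiv ℝ f) x :=
    (hf.fderiv_right (m := 1) (by norm_num)).differentiableAt (by norm_num)
  rw [fderiv_clm_apply hd (differentiableAt_const v),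
    fderiv_clm_apply hd (differentiableAt_const w)]
  simpa using (hf.isSymmSndFDerivAt (by simp)).eq w v

/-- The second-order operator `∑ j, ∂_{e j}²`. -/
def sumSecondDeriv {V ι : Type*} [NormedAddCommGroup V] [NormedSpace ℝ V] [Fintype ι]
    (e : ι → V) (f : V → ℂ) (x : V) : ℂ :=
  ∑ j, fderiv ℝ (fun y => fderiv ℝ f y (e j)) x (e j)

theorem UniformlySchwartz.sumSecondDeriv {V ι : Type*} [NormedAddCommGroup V] [NormedSpace ℝ V]
    [Fintype ι] {S : Set ℝ} {U : ℝ → V → ℂ} (hU : UniformlySchwartz S U) (e : ι → V) :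
    UniformlySchwartz S (fun t => sumSecondDeriv e (U t)) :=
  .sum _ fun j _ => (hU.fderiv_apply (e j)).fderiv_apply (e j)

/-- A Morawetz weight with gradient components `q j` along the directions `e j`, whose Hessian
is `σ (c k j - q k q j)` and such that the bilaplacian is `-60 κ² σ⁷`. -/
structure IsMorawetzWeight {V ι : Type*} [NormedAddCommGroup V] [NormedSpace ℝ V] [Fintype ι]
    (e : ι → V) (κ : ℝ) (σ : V →ᵇ ℝ) (q : ι → V →ᵇ ℝ) (c : ι → ι → ℝ) : Prop where
  differentiable_σ : Differentiable ℝ σ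
  differentiable_q : ∀ j, Differentiable ℝ (q j)
  fderiv_σ : ∀ k x, fderiv ℝ σ x (e k) = -(σ x ^ 2 * q k x)
  fderiv_q : ∀ j k x, fderiv ℝ (q j) x (e k) = σ x * (c k j - q k x * q j x)
  sum_q_sq : ∀ x, ∑ j, q j x ^ 2 = 2 * (1 - κ * σ x ^ 2)
  sum_c : ∑ j, c j j = 6
  hessian_nonneg : ∀ x (z : ι → ℂ),
    0 ≤ ∑ j, ∑ k, σ x * (c k j - q k x * q j x) * inner ℝ (z j) (z k)

theorem IsMorawetzWeight.le_integral {V ι : Type*} [NormedAddCommGroup V] [NormedSpace ℝ V]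
    [FiniteDimensional ℝ V] [MeasurableSpace V] [BorelSpace V] {μ : Measure V}
    [μ.IsAddHaarMeasure] [Fintype ι]
    {e : ι → V} {κ : ℝ} {σ : V →ᵇ ℝ} {q : ι → V →ᵇ ℝ} {c : ι → ι → ℝ}
    (hw : IsMorawetzWeight e κ σ q c) {S : Set ℝ} {U : ℝ → V → ℂ} (hU : UniformlySchwartz S U)
    {t : ℝ} (ht : t ∈ S) :
    30 * κ ^ 2 * ∫ x, σ x ^ 7 * ‖U t x‖ ^ 2 ∂μ ≤
      ∫ x, ∑ j, q j x * (inner ℝ (U t x) (fderiv ℝ (sumSecondDeriv e (U t)) x (e j)) -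
        inner ℝ (sumSecondDeriv e (U t) x) (fderiv ℝ (U t) x (e j))) ∂μ := by
  have hΔ := hU.sumSecondDeriv e
  have h1 := fun j => hU.fderiv_apply (e j)
  have h2 := fun j k => (h1 j).fderiv_apply (e k)
  let cst : ℝ → V →ᵇ ℝ := BoundedContinuousFunction.const V
  let H : ι → ι → V →ᵇ ℝ := fun j k => σ * (cst (c k j) - q k * q j)
  let L : V →ᵇ ℝ := cst 4 * σ + cst (2 * κ) * σ ^ 3
  let L1 : ι → V →ᵇ ℝ := fun k => (cst (-4) * σ ^ 2 + cst (-6 * κ) * σ ^ 4) * q k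
  let L2 : ι → V →ᵇ ℝ := fun k => (cst 12 * σ ^ 3 + cst (30 * κ) * σ ^ 5) * q k ^ 2 +
    (cst (-4) * σ ^ 3 + cst (-6 * κ) * σ ^ 5) * cst (c k k)
  have hσ' : ∀ x, HasFDerivAt σ (fderiv ℝ σ x) x := fun x => (hw.differentiable_σ x).hasFDerivAt
  have hq' : ∀ j x, HasFDerivAt (q j) (fderiv ℝ (q j) x) x :=
    fun j x => (hw.differentiable_q j x).hasFDerivAt
  have hH : ∀ j k x, fderiv ℝ (q j) x (e k) = H j k x := fun j k x => hw.fderiv_q j k x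
  have hL' : ∀ x, HasFDerivAt L _ x := fun x =>
    ((hσ' x).const_mul 4).add (((hσ' x).pow 3).const_mul (2 * κ))
  have hL : ∀ k x, fderiv ℝ L x (e k) = L1 k x := fun k x => by
    rw [(hL' x).fderiv]
    simp [L1, cst, hw.fderiv_σ]
    ring
  have hL1' : ∀ k x, HasFDerivAt (L1 k) _ x := fun k x =>
    ((((hσ' x).pow 2).const_mul (-4)).add (((hσ' x).pow 4).const_mul (-6 * κ))).mul (hq' k x)
  have hL1 : ∀ k x, fderiv ℝ (L1 k) x (e k) = L2 k x := fun k x => by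
    rw [(hL1' k x).fderiv]
    simp [L2, cst, hw.fderiv_σ, hw.fderiv_q]
    ring
  have dL : Differentiable ℝ L := fun x => (hL' x).differentiableAt
  have dL1 : ∀ k, Differentiable ℝ (L1 k) := fun k x => (hL1' k x).differentiableAt
  have sumH : ∀ x, ∑ j, H j j x = L x := fun x => by
    have : ∀ j, H j j x = σ x * c j j - σ x * q j x ^ 2 := fun j => by simp [H, cst]; ring
    simp only [this, Finset.sum_sub_distrib, ← Finset.mul_sum, hw.sum_q_sq, hw.sum_c]
    simp [L, cst]
    ring
  have sumL2 : ∀ x, ∑ k, L2 k x = -(60 * κ ^ 2 * σ x ^ 7) := fun x => by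
    have : ∀ k, L2 k x = (12 * σ x ^ 3 + 30 * κ * σ x ^ 5) * q k x ^ 2 +
      (-4 * σ x ^ 3 + -6 * κ * σ x ^ 5) * c k k := fun _ => rfl
    simp only [this, Finset.sum_add_distrib, ← Finset.mul_sum, hw.sum_q_sq, hw.sum_c]
    ring
  have e1 : ∀ j, ∫ x, q j x * inner ℝ (U t x) (fderiv ℝ (sumSecondDeriv e (U t)) x (e j)) ∂μ =
      -(∫ x, H j j x * inner ℝ (U t x) (sumSecondDeriv e (U t) x) ∂μ) -
        ∫ x, q j x * inner ℝ (fderiv ℝ (U t) x (e j)) (sumSecondDeriv e (U t) x) ∂μ := fun j =>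
    hU.integral_by_parts hΔ ht (e j) (hw.differentiable_q j) (hH j j)
  have e2 : ∀ k, ∫ x, L x * inner ℝ (U t x)
        (fderiv ℝ (fun y => fderiv ℝ (U t) y (e k)) x (e k)) ∂μ =
      -(∫ x, L1 k x * inner ℝ (U t x) (fderiv ℝ (U t) x (e k)) ∂μ) -
        ∫ x, L x * inner ℝ (fderiv ℝ (U t) x (e k)) (fderiv ℝ (U t) x (e k)) ∂μ := fun k =>
    hU.integral_by_parts (h1 k) ht (e k) dL (hL k)
  have e3 : ∀ k, ∫ x, L1 k x * inner ℝ (U t x) (fderiv ℝ (U t) x (e k)) ∂μ =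
      -(∫ x, L2 k x * inner ℝ (U t x) (U t x) ∂μ) -
        ∫ x, L1 k x * inner ℝ (U t x) (fderiv ℝ (U t) x (e k)) ∂μ := fun k => by
    have := hU.integral_by_parts (μ := μ) hU ht (e k) (dL1 k) (hL1 k)
    simpa only [real_inner_comm (U t _) (fderiv ℝ (U t) _ _)] using this
  have e4 : ∀ j k, ∫ x, q j x * inner ℝ (fderiv ℝ (U t) x (e j))
        (fderiv ℝ (fun y => fderiv ℝ (U t) y (e k)) x (e k)) ∂μ =
      -(∫ x, H j k x * inner ℝ (fderiv ℝ (U t) x (e j)) (fderiv ℝ (U t) x (e k)) ∂μ) -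
        ∫ x, q j x * inner ℝ (fderiv ℝ (fun y => fderiv ℝ (U t) y (e j)) x (e k))
          (fderiv ℝ (U t) x (e k)) ∂μ := fun j k =>
    (h1 j).integral_by_parts (h1 k) ht (e k) (hw.differentiable_q j) (hH j k)
  have e5 : ∀ j k, ∫ x, q j x * inner ℝ (fderiv ℝ (fun y => fderiv ℝ (U t) y (e j)) x (e k))
          (fderiv ℝ (U t) x (e k)) ∂μ =
      -(∫ x, H j j x * inner ℝ (fderiv ℝ (U t) x (e k)) (fderiv ℝ (U t) x (e k)) ∂μ) -
        ∫ x, q j x * inner ℝ (fderiv ℝ (fun y => fderiv ℝ (U t) y (e j)) x (e k))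
          (fderiv ℝ (U t) x (e k)) ∂μ := fun j k => by
    have hc : ∀ x, fderiv ℝ (fun y => fderiv ℝ (U t) y (e k)) x (e j) =
        fderiv ℝ (fun y => fderiv ℝ (U t) y (e j)) x (e k) := fun x =>
      fderiv_fderiv_apply_comm (contDiff_infty.1 (hU.1 t ht) 2).contDiffAt _ _
    have := (h1 k).integral_by_parts (μ := μ) (h1 k) ht (e j) (hw.differentiable_q j) (hH j j)
    simp only [hc] at this
    simpa only [real_inner_comm (fderiv ℝ (fun y => fderiv ℝ (U t) y (e j)) _ (e k))] using this
  have s1 : ∑ j, ∫ x, H j j x * inner ℝ (U t x) (sumSecondDeriv e (U t) x) ∂μ =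
      ∑ k, ∫ x, L x * inner ℝ (U t x)
        (fderiv ℝ (fun y => fderiv ℝ (U t) y (e k)) x (e k)) ∂μ := by
    rw [← integral_finsetSum _ fun j _ => hU.integrable_mul_inner hΔ ht _,
      ← integral_finsetSum _ fun j _ => hU.integrable_mul_inner (h2 j j) ht _]
    congr 1 with x
    rw [← Finset.sum_mul, sumH, ← Finset.mul_sum, ← inner_sum]
    rfl
  have s2 : ∀ k, ∑ j, ∫ x, H j j x * inner ℝ (fderiv ℝ (U t) x (e k)) (fderiv ℝ (U t) x (e k)) ∂μ
      = ∫ x, L x * inner ℝ (fderiv ℝ (U t) x (e k)) (fderiv ℝ (U t) x (e k)) ∂μ := fun k => by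
    rw [← integral_finsetSum _ fun j _ => (h1 k).integrable_mul_inner (h1 k) ht _]
    congr 1 with x
    rw [← Finset.sum_mul, sumH]
  have s3 : ∑ k, ∫ x, L2 k x * inner ℝ (U t x) (U t x) ∂μ =
      -(60 * κ ^ 2 * ∫ x, σ x ^ 7 * ‖U t x‖ ^ 2 ∂μ) := by
    rw [← integral_finsetSum _ fun j _ => hU.integrable_mul_inner hU ht _, ← integral_const_mul,
      ← integral_neg]
    congr 1 with x
    rw [← Finset.sum_mul, sumL2, real_inner_self_eq_norm_sq]
    ring
  have s4 : ∀ j, ∫ x, q j x * inner ℝ (fderiv ℝ (U t) x (e j)) (sumSecondDeriv e (U t) x) ∂μ =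
      ∑ k, ∫ x, q j x * inner ℝ (fderiv ℝ (U t) x (e j))
        (fderiv ℝ (fun y => fderiv ℝ (U t) y (e k)) x (e k)) ∂μ := fun j => by
    rw [← integral_finsetSum _ fun k _ => (h1 j).integrable_mul_inner (h2 k k) ht _]
    congr 1 with x
    rw [← Finset.mul_sum, ← inner_sum]
    rfl
  have s5 : 0 ≤ ∑ j, ∑ k,
      ∫ x, H j k x * inner ℝ (fderiv ℝ (U t) x (e j)) (fderiv ℝ (U t) x (e k)) ∂μ := by
    simp_rw [← integral_finsetSum Finset.univ
      fun k _ => (h1 _).integrable_mul_inner (μ := μ) (h1 k) ht (H _ k)]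
    rw [← integral_finsetSum _ fun j _ => integrable_finsetSum _
      fun k _ => (h1 j).integrable_mul_inner (h1 k) ht _]
    exact integral_nonneg fun x => hw.hessian_nonneg x fun j => fderiv ℝ (U t) x (e j)
  have s6 : ∫ x, ∑ j, q j x * (inner ℝ (U t x) (fderiv ℝ (sumSecondDeriv e (U t)) x (e j)) -
        inner ℝ (sumSecondDeriv e (U t) x) (fderiv ℝ (U t) x (e j))) ∂μ =
      ∑ j, (∫ x, q j x * inner ℝ (U t x) (fderiv ℝ (sumSecondDeriv e (U t)) x (e j)) ∂μ -
        ∫ x, q j x * inner ℝ (fderiv ℝ (U t) x (e j)) (sumSecondDeriv e (U t) x) ∂μ) := by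
    have i1 := fun j => hU.integrable_mul_inner (μ := μ) (hΔ.fderiv_apply (e j)) ht (q j)
    have i2 := fun j => (h1 j).integrable_mul_inner (μ := μ) hΔ ht (q j)
    simp_rw [← integral_sub (i1 _) (i2 _)]
    refine Eq.trans ?_ (integral_finsetSum _ fun j _ => (i1 j).sub (i2 j))
    congr 1 with x
    refine Finset.sum_congr rfl fun j _ => ?_
    rw [real_inner_comm (fderiv ℝ (U t) x (e j)), mul_sub]
  have f1 : ∑ j, ∫ x, H j j x * inner ℝ (U t x) (sumSecondDeriv e (U t) x) ∂μ =
      -(30 * κ ^ 2 * ∫ x, σ x ^ 7 * ‖U t x‖ ^ 2 ∂μ) -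
        ∑ k, ∫ x, L x * inner ℝ (fderiv ℝ (U t) x (e k)) (fderiv ℝ (U t) x (e k)) ∂μ := by
    rw [s1, Finset.sum_congr rfl fun k _ => e2 k, Finset.sum_sub_distrib, Finset.sum_neg_distrib]
    have := Finset.sum_congr (rfl : (Finset.univ : Finset ι) = _) fun k _ => e3 k
    rw [Finset.sum_sub_distrib, Finset.sum_neg_distrib, s3] at this
    linarith
  have f2 : 2 * ∑ j, ∑ k, ∫ x, q j x * inner ℝ (fderiv ℝ (U t) x (e j))
        (fderiv ℝ (fun y => fderiv ℝ (U t) y (e k)) x (e k)) ∂μ =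
      -(2 * ∑ j, ∑ k,
        ∫ x, H j k x * inner ℝ (fderiv ℝ (U t) x (e j)) (fderiv ℝ (U t) x (e k)) ∂μ) +
        ∑ k, ∫ x, L x * inner ℝ (fderiv ℝ (U t) x (e k)) (fderiv ℝ (U t) x (e k)) ∂μ := by
    rw [← Finset.sum_congr rfl fun k _ => s2 k, Finset.sum_comm (f := fun k j =>
      ∫ x, H j j x * inner ℝ (fderiv ℝ (U t) x (e k)) (fderiv ℝ (U t) x (e k)) ∂μ)]
    simp only [Finset.mul_sum, ← Finset.sum_neg_distrib, ← Finset.sum_add_distrib]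
    refine Finset.sum_congr rfl fun j _ => Finset.sum_congr rfl fun k _ => ?_
    linarith [e4 j k, e5 j k]
  rw [s6, Finset.sum_congr rfl fun j _ => by rw [e1 j], Finset.sum_congr rfl fun j _ => by
    rw [show ∀ a b : ℝ, -a - b - b = -a - 2 * b by intros; ring, s4 j], Finset.sum_sub_distrib,
    Finset.sum_neg_distrib, f1, ← Finset.mul_sum, f2]
  linarith

theorem hasDerivAt_fderiv_apply {V : Type*} [NormedAddCommGroup V] [NormedSpace ℝ V]
    {S : Set ℝ} (hS : IsOpen S) {U W : ℝ → V → ℂ}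
    (hsm : ContDiffOn ℝ (⊤ : ℕ∞) (fun p : ℝ × V => U p.1 p.2) (S ×ˢ Set.univ))
    (hW : ∀ t ∈ S, ∀ x, deriv (fun s => U s x) t = W t x) {t : ℝ} (ht : t ∈ S) (x v : V) :
    HasDerivAt (fun s => fderiv ℝ (U s) x v) (fderiv ℝ (W t) x v) t := by
  set f : ℝ × V → ℂ := fun p => U p.1 p.2 with hf
  have hfc : ∀ s ∈ S, ∀ y, ContDiffAt ℝ (⊤ : ℕ∞) f (s, y) := fun s hs y =>
    hsm.contDiffAt ((hS.prod isOpen_univ).mem_nhds ⟨hs, trivial⟩)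
  have hfd : ∀ s ∈ S, ∀ y, HasFDerivAt f (fderiv ℝ f (s, y)) (s, y) := fun s hs y =>
    ((hfc s hs y).differentiableAt (by simp)).hasFDerivAt
  have hx : ∀ s ∈ S, ∀ y, fderiv ℝ (U s) y v = fderiv ℝ f (s, y) (0, v) := fun s hs y => by
    have h := HasFDerivAt.comp y (hfd s hs y) (hasFDerivAt_prodMk_right s y)
    change HasFDerivAt (U s) _ y at h
    rw [h.fderiv]
    simp
  have ht' : ∀ s ∈ S, ∀ y, deriv (fun r => U r y) s = fderiv ℝ f (s, y) (1, 0) := fun s hs y => by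
    have h := (HasFDerivAt.comp s (hfd s hs y) (hasFDerivAt_prodMk_left s y)).hasDerivAt
    change HasDerivAt (fun r => U r y) _ s at h
    rw [h.deriv]
    simp
  have hdd : DifferentiableAt ℝ (fderiv ℝ f) (t, x) :=
    (((contDiffAt_infty.1 (hfc t ht x)) 2).fderiv_right (m := 1) (by norm_num)).differentiableAt
      (by norm_num)
  have hv : DifferentiableAt ℝ (fun p => fderiv ℝ f p (0, v)) (t, x) :=
    hdd.clm_apply (differentiableAt_const _)
  have h1 : DifferentiableAt ℝ (fun p => fderiv ℝ f p (1, 0)) (t, x) :=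
    hdd.clm_apply (differentiableAt_const _)
  have hd1 : HasDerivAt (fun s => fderiv ℝ f (s, x) (0, v))
      (fderiv ℝ (fun p => fderiv ℝ f p (0, v)) (t, x) (1, 0)) t := by
    have h := (HasFDerivAt.comp t hv.hasFDerivAt (hasFDerivAt_prodMk_left t x)).hasDerivAt
    change HasDerivAt (fun s => fderiv ℝ f (s, x) (0, v)) _ t at h
    simpa using h
  have hd2 : fderiv ℝ (W t) x v = fderiv ℝ (fun p => fderiv ℝ f p (1, 0)) (t, x) (0, v) := by
    have h := HasFDerivAt.comp x h1.hasFDerivAt (hasFDerivAt_prodMk_right t x)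
    have hWt : W t = (fun p => fderiv ℝ f p (1, 0)) ∘ fun y => (t, y) := by
      ext y
      rw [← hW t ht y, ht' t ht y, Function.comp]
    rw [← hWt] at h
    rw [h.fderiv]
    simp
  rw [hd2, ← fderiv_fderiv_apply_comm ((contDiffAt_infty.1 (hfc t ht x)) 2)]
  refine hd1.congr_of_eventuallyEq ?_
  filter_upwards [hS.mem_nhds ht] with s hs using hx s hs x

/-- The Morawetz action `∫ ∇A · Im(Ū ∇U)`, where `∇A` has components `q j`. -/
def morawetzAction {V ι : Type*} [NormedAddCommGroup V] [NormedSpace ℝ V] [MeasurableSpace V]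
    [Fintype ι] (μ : Measure V) (e : ι → V) (q : ι → V →ᵇ ℝ) (f : V → ℂ) : ℝ :=
  ∫ x, ∑ j, q j x * inner ℝ (Complex.I * f x) (fderiv ℝ f x (e j)) ∂μ

theorem inner_I_mul_I_mul (a b : ℂ) :
    inner ℝ (Complex.I * a) (Complex.I * b) = inner ℝ a b := by
  simp [Complex.inner]

theorem inner_I_mul_I_mul_left (a b : ℂ) :
    inner ℝ (Complex.I * (Complex.I * a)) b = -inner ℝ a b := by
  rw [← mul_assoc, Complex.I_mul_I, neg_one_mul, inner_neg_left]

section Derivative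

variable {V ι : Type*} [NormedAddCommGroup V] [NormedSpace ℝ V]
    [FiniteDimensional ℝ V] [MeasurableSpace V] [BorelSpace V] {μ : Measure V}
    [μ.IsAddHaarMeasure] [Fintype ι] {S : Set ℝ} {U : ℝ → V → ℂ}

theorem hasDerivAt_morawetzAction (hS : IsOpen S) (e : ι → V) (q : ι → V →ᵇ ℝ)
    (hU : UniformlySchwartz S U)
    (hsm : ContDiffOn ℝ (⊤ : ℕ∞) (fun p : ℝ × V => U p.1 p.2) (S ×ˢ Set.univ))
    (hpde : ∀ t ∈ S, ∀ x, deriv (fun s => U s x) t = Complex.I * sumSecondDeriv e (U t) x)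
    {t : ℝ} (ht : t ∈ S) :
    HasDerivAt (fun s => morawetzAction μ e q (U s))
      (∫ x, ∑ j, q j x * (inner ℝ (U t x) (fderiv ℝ (sumSecondDeriv e (U t)) x (e j)) -
        inner ℝ (sumSecondDeriv e (U t) x) (fderiv ℝ (U t) x (e j))) ∂μ) t := by
  have hΔ := hU.sumSecondDeriv e
  have h1 := fun j => hU.fderiv_apply (e j)
  have h3 := fun j => hΔ.fderiv_apply (e j)
  have hUt : ∀ s ∈ S, ∀ x, HasDerivAt (fun r => U r x) (Complex.I * sumSecondDeriv e (U s) x) s :=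
    fun s hs x => by
    rw [← hpde s hs x]
    have hd : DifferentiableAt ℝ (fun p : ℝ × V => U p.1 p.2) (s, x) :=
      (hsm.contDiffAt ((hS.prod isOpen_univ).mem_nhds ⟨hs, trivial⟩)).differentiableAt (by simp)
    exact (DifferentiableAt.comp s hd (hasFDerivAt_prodMk_left s x).differentiableAt).hasDerivAt
  have hUxt : ∀ s ∈ S, ∀ x j, HasDerivAt (fun r => fderiv ℝ (U r) x (e j))
      (Complex.I * fderiv ℝ (sumSecondDeriv e (U s)) x (e j)) s := fun s hs x j => by
    have := hasDerivAt_fderiv_apply hS hsm (W := fun t x => Complex.I * sumSecondDeriv e (U t) x)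
      hpde hs x (e j)
    rwa [fderiv_const_mul (hΔ.differentiable hs x)] at this
  have hcont : ∀ s ∈ S, Continuous
      fun x => ∑ j, q j x * inner ℝ (Complex.I * U s x) (fderiv ℝ (U s) x (e j)) := fun s hs =>
    continuous_finsetSum _ fun j _ => (q j).continuous.mul
      ((continuous_const.mul (hU.continuous hs)).inner ((h1 j).continuous hs))
  choose A hA0 hA using fun j => hU.exists_norm_mul_norm_le (h3 j) (Module.finrank ℝ V + 1)
  choose B hB0 hB using fun j => hΔ.exists_norm_mul_norm_le (h1 j) (Module.finrank ℝ V + 1)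
  refine (hasDerivAt_integral_of_dominated_loc_of_deriv_le (μ := μ) (s := S)
    (bound := fun x => ∑ j, ‖q j‖ * (A j + B j) *
      (1 + ‖x‖) ^ (-((Module.finrank ℝ V + 1 : ℕ) : ℝ)))
    (F := fun s x => ∑ j, q j x * inner ℝ (Complex.I * U s x) (fderiv ℝ (U s) x (e j)))
    (F' := fun s x => ∑ j, q j x * (inner ℝ (U s x) (fderiv ℝ (sumSecondDeriv e (U s)) x (e j)) -
        inner ℝ (sumSecondDeriv e (U s) x) (fderiv ℝ (U s) x (e j))))
    (hS.mem_nhds ht) ?_ ?_ ?_ ?_ ?_ ?_).2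
  · filter_upwards [hS.mem_nhds ht] with s hs using (hcont s hs).aestronglyMeasurable
  · refine integrable_finsetSum _ fun j _ =>
      (((hU.integrable_norm_mul_norm (μ := μ) (h1 j) ht).const_mul ‖q j‖).mono'
      ((q j).continuous.mul ((continuous_const.mul (hU.continuous ht)).inner
        ((h1 j).continuous ht))).aestronglyMeasurable (.of_forall fun x => ?_))
    rw [norm_mul]
    refine mul_le_mul ((q j).norm_coe_le_norm x) ((norm_inner_le_norm _ _).trans ?_)
      (norm_nonneg _) (norm_nonneg _)
    simp
  · exact (continuous_finsetSum _ fun j _ => (q j).continuous.mul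
      (((hU.continuous ht).inner ((h3 j).continuous ht)).sub
        ((hΔ.continuous ht).inner ((h1 j).continuous ht)))).aestronglyMeasurable
  · refine .of_forall fun x s hs => (norm_sum_le _ _).trans (Finset.sum_le_sum fun j _ => ?_)
    rw [norm_mul, mul_assoc]
    refine mul_le_mul ((q j).norm_coe_le_norm x) ((norm_sub_le _ _).trans ?_) (norm_nonneg _)
      (norm_nonneg _)
    rw [add_mul]
    exact add_le_add ((norm_inner_le_norm _ _).trans (hA j s hs x))
      ((norm_inner_le_norm _ _).trans (hB j s hs x))
  · exact integrable_finsetSum _ fun j _ =>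
      (integrable_one_add_norm (by push_cast; linarith)).const_mul _
  · refine .of_forall fun x s hs => HasDerivAt.fun_sum fun j _ => ?_
    have := ((((hUt s hs x).const_mul Complex.I).inner ℝ (hUxt s hs x j)).const_mul (q j x))
    rwa [inner_I_mul_I_mul, inner_I_mul_I_mul_left, ← sub_eq_add_neg] at this

/-- The integrated Morawetz inequality on a compact time interval. -/
theorem IsMorawetzWeight.integral_le {e : ι → V} {κ : ℝ} {σ : V →ᵇ ℝ} {q : ι → V →ᵇ ℝ}
    {c : ι → ι → ℝ} (hw : IsMorawetzWeight e κ σ q c) (hS : IsOpen S)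
    (hU : UniformlySchwartz S U)
    (hsm : ContDiffOn ℝ (⊤ : ℕ∞) (fun p : ℝ × V => U p.1 p.2) (S ×ˢ Set.univ))
    (hpde : ∀ t ∈ S, ∀ x, deriv (fun s => U s x) t = Complex.I * sumSecondDeriv e (U t) x)
    {B : ℝ} (hB : ∀ t ∈ S, |morawetzAction μ e q (U t)| ≤ B) {φ : ℝ → ℝ}
    (hφ : ∀ t ∈ S, φ t ≤ 30 * κ ^ 2 * ∫ x, σ x ^ 7 * ‖U t x‖ ^ 2 ∂μ) {a b : ℝ} (hab : a ≤ b)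
    (hS' : Set.Icc a b ⊆ S) (hφi : IntegrableOn φ (Set.Icc a b)) :
    ∫ t in a..b, φ t ≤ 2 * B := by
  have hd := fun t (ht : t ∈ S) => hasDerivAt_morawetzAction (μ := μ) hS e q hU hsm hpde ht
  have := intervalIntegral.integral_le_sub_of_hasDeriv_right_of_le hab
    (fun t ht => (hd t (hS' ht)).continuousAt.continuousWithinAt)
    (fun t ht => (hd t (hS' (Set.Ioo_subset_Icc_self ht))).hasDerivWithinAt) hφi
    fun t ht => (hφ t (hS' (Set.Ioo_subset_Icc_self ht))).trans
      (hw.le_integral hU (hS' (Set.Ioo_subset_Icc_self ht)))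
  have h1 := abs_le.1 (hB a (hS' (Set.left_mem_Icc.2 hab)))
  have h2 := abs_le.1 (hB b (hS' (Set.right_mem_Icc.2 hab)))
  linarith

end Derivative

theorem norm_sq_add_sq_pos {F : Type*} [NormedAddCommGroup F] {ε : ℝ} (hε : 0 < ε) (w : F) :
    0 < ‖w‖ ^ 2 + ε ^ 2 := by
  positivity

section Weight

variable {V F : Type*} [NormedAddCommGroup V] [NormedSpace ℝ V] [NormedAddCommGroup F]
  [InnerProductSpace ℝ F] (P : V →L[ℝ] F) {ε : ℝ} (hε : 0 < ε)

/-- The regularised inverse distance `(‖P x‖² + ε²)^{-1/2}`. -/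
def invRegNorm : V →ᵇ ℝ :=
  .ofNormedAddCommGroup (fun x => (√(‖P x‖ ^ 2 + ε ^ 2))⁻¹)
    ((Real.continuous_sqrt.comp (by fun_prop)).inv₀ fun x =>
      (Real.sqrt_pos.2 (norm_sq_add_sq_pos hε (P x))).ne') ε⁻¹ fun x => by
    rw [Real.norm_of_nonneg (by positivity)]
    exact inv_anti₀ hε (Real.le_sqrt_of_sq_le (by nlinarith [sq_nonneg ‖P x‖]))

theorem invRegNorm_pos (x : V) : 0 < invRegNorm P hε x :=
  inv_pos.2 (Real.sqrt_pos.2 (norm_sq_add_sq_pos hε (P x)))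

theorem invRegNorm_sq_mul (x : V) : invRegNorm P hε x ^ 2 * (‖P x‖ ^ 2 + ε ^ 2) = 1 := by
  have h := norm_sq_add_sq_pos hε (P x)
  change (√(‖P x‖ ^ 2 + ε ^ 2))⁻¹ ^ 2 * _ = 1
  rw [inv_pow, Real.sq_sqrt h.le, inv_mul_cancel₀ h.ne']

theorem invRegNorm_mul_norm_le (x : V) : invRegNorm P hε x * ‖P x‖ ≤ 1 := by
  have h := invRegNorm_sq_mul P hε x
  have h0 := invRegNorm_pos P hε x
  refine abs_le_of_sq_le_sq' ?_ zero_le_one |>.2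
  nlinarith [sq_nonneg (invRegNorm P hε x * ε)]

/-- The derivative of `√(‖P x‖² + ε²)` in the direction `v`. -/
def regNormDeriv (v : V) : V →ᵇ ℝ :=
  .ofNormedAddCommGroup (fun x => invRegNorm P hε x * inner ℝ (P x) (P v))
    ((invRegNorm P hε).continuous.mul (by fun_prop)) ‖P v‖ fun x => by
    rw [norm_mul, Real.norm_of_nonneg (invRegNorm_pos P hε x).le]
    calc _ ≤ invRegNorm P hε x * (‖P x‖ * ‖P v‖) := by
          gcongr
          exacts [(invRegNorm_pos P hε x).le, norm_inner_le_norm _ _]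
      _ = invRegNorm P hε x * ‖P x‖ * ‖P v‖ := by ring
      _ ≤ 1 * ‖P v‖ := by
          gcongr
          exact invRegNorm_mul_norm_le P hε x
      _ = _ := one_mul _

theorem regNormDeriv_apply (v x : V) :
    regNormDeriv P hε v x = invRegNorm P hε x * inner ℝ (P x) (P v) := rfl

theorem hasFDerivAt_invRegNorm (x : V) : HasFDerivAt (invRegNorm P hε)
    (-(invRegNorm P hε x ^ 3) • (innerSL ℝ (P x)).comp P) x := by
  have h := norm_sq_add_sq_pos hε (P x)
  have hs := (Real.sqrt_pos.2 h).ne'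
  have h1 : HasFDerivAt (fun x => ‖P x‖ ^ 2 + ε ^ 2) (2 • (innerSL ℝ (P x)).comp P) x :=
    (P.hasFDerivAt.norm_sq).add_const _
  refine ((hasDerivAt_inv hs).comp_hasFDerivAt x (h1.sqrt h.ne')).congr_fderiv ?_
  ext v
  have : invRegNorm P hε x = (√(‖P x‖ ^ 2 + ε ^ 2))⁻¹ := rfl
  rw [this]
  simp
  field_simp

variable {ι : Type*} [Fintype ι]

theorem isMorawetzWeight {e : ι → V} (he : ∀ w, ∑ j, inner ℝ w (P (e j)) ^ 2 = 2 * ‖w‖ ^ 2)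
    (he' : ∑ j, ‖P (e j)‖ ^ 2 = 6) :
    IsMorawetzWeight e (ε ^ 2) (invRegNorm P hε) (fun j => regNormDeriv P hε (e j))
      (fun k j => inner ℝ (P (e k)) (P (e j))) := by
  have hq : ∀ v x, HasFDerivAt (regNormDeriv P hε v) _ x := fun v x =>
    (hasFDerivAt_invRegNorm P hε x).mul (P.hasFDerivAt.inner ℝ (hasFDerivAt_const (P v) x))
  refine ⟨fun x => (hasFDerivAt_invRegNorm P hε x).differentiableAt,
    fun j x => (hq (e j) x).differentiableAt, fun k x => ?_, fun j k x => ?_, fun x => ?_, ?_,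
    fun x z => ?_⟩
  · rw [(hasFDerivAt_invRegNorm P hε x).fderiv, regNormDeriv_apply]
    simp
    ring
  · rw [(hq (e j) x).fderiv, regNormDeriv_apply, regNormDeriv_apply]
    simp
    ring
  · simp only [regNormDeriv_apply, mul_pow, ← Finset.mul_sum, he]
    linear_combination 2 * invRegNorm_sq_mul P hε x
  · simpa using he'
  · set s := invRegNorm P hε x
    have hs : 0 < s := invRegNorm_pos P hε x
    have key : ∀ a : ι → ℝ, 0 ≤ ∑ j, ∑ k, s * (inner ℝ (P (e k)) (P (e j)) -
        regNormDeriv P hε (e k) x * regNormDeriv P hε (e j) x) * (a j * a k) := fun a => by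
      set g := ∑ j, a j • P (e j)
      have h1 : ∑ j, ∑ k, inner ℝ (P (e k)) (P (e j)) * (a j * a k) = ‖g‖ ^ 2 := by
        rw [← real_inner_self_eq_norm_sq, sum_inner]
        refine Finset.sum_congr rfl fun j _ => ?_
        rw [inner_sum]
        refine Finset.sum_congr rfl fun k _ => ?_
        rw [real_inner_smul_left, real_inner_smul_right, real_inner_comm]
        ring
      have h2 : inner ℝ (P x) g = ∑ j, a j * inner ℝ (P x) (P (e j)) := by
        simp [g, inner_sum, real_inner_smul_right]
      have h3 : ∑ j, ∑ k, s * (inner ℝ (P (e k)) (P (e j)) -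
          regNormDeriv P hε (e k) x * regNormDeriv P hε (e j) x) * (a j * a k) =
          s * (‖g‖ ^ 2 - s ^ 2 * inner ℝ (P x) g ^ 2) := by
        rw [← h1, h2, sq (∑ j, _), Finset.sum_mul_sum, Finset.mul_sum, ← Finset.sum_sub_distrib,
          Finset.mul_sum]
        refine Finset.sum_congr rfl fun j _ => ?_
        rw [Finset.mul_sum, ← Finset.sum_sub_distrib, Finset.mul_sum]
        refine Finset.sum_congr rfl fun k _ => ?_
        rw [regNormDeriv_apply, regNormDeriv_apply]
        ring
      rw [h3]
      refine mul_nonneg hs.le (sub_nonneg.2 ?_)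
      have h4 := abs_real_inner_le_norm (P x) g
      have h5 := invRegNorm_mul_norm_le P hε x
      rw [← mul_pow]
      refine sq_le_sq.2 ?_
      rw [abs_mul, abs_of_pos hs, abs_of_nonneg (norm_nonneg g)]
      calc _ ≤ s * (‖P x‖ * ‖g‖) := by gcongr
        _ = s * ‖P x‖ * ‖g‖ := by ring
        _ ≤ 1 * ‖g‖ := by gcongr
        _ = _ := one_mul _
    have := add_nonneg (key fun j => (z j).re) (key fun j => (z j).im)
    rw [← Finset.sum_add_distrib] at this
    refine this.trans_eq (Finset.sum_congr rfl fun j _ => ?_)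
    rw [← Finset.sum_add_distrib]
    refine Finset.sum_congr rfl fun k _ => ?_
    rw [Complex.inner]
    simp
    ring

end Weight

section Tensor

variable {E ι : Type*} [NormedAddCommGroup E] [NormedSpace ℝ E]

/-- The directions of `E × E` obtained by placing each `b a` in either factor. -/
def pairDirections (b : ι → E) : ι ⊕ ι → E × E :=
  Sum.elim (fun a => (b a, 0)) (fun a => (0, b a))

theorem fderiv_prod_mul_apply {f g : E → ℂ} {p : E × E} (hf : DifferentiableAt ℝ f p.1)
    (hg : DifferentiableAt ℝ g p.2) (v : E × E) :
    fderiv ℝ (fun p : E × E => f p.1 * g p.2) p v =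
      fderiv ℝ f p.1 v.1 * g p.2 + f p.1 * fderiv ℝ g p.2 v.2 := by
  have h1 : HasFDerivAt (fun p : E × E => f p.1) _ p := hf.hasFDerivAt.comp p hasFDerivAt_fst
  have h2 : HasFDerivAt (fun p : E × E => g p.2) _ p := hg.hasFDerivAt.comp p hasFDerivAt_snd
  have h3 : HasFDerivAt (fun p : E × E => f p.1 * g p.2) _ p := h1.mul h2
  rw [h3.fderiv]
  simp
  ring

theorem sumSecondDeriv_prod_mul [Fintype ι] (b : ι → E) {f g : E → ℂ} (hf : ContDiff ℝ 2 f)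
    (hg : ContDiff ℝ 2 g) (p : E × E) :
    sumSecondDeriv (pairDirections b) (fun p : E × E => f p.1 * g p.2) p =
      sumSecondDeriv b f p.1 * g p.2 + f p.1 * sumSecondDeriv b g p.2 := by
  have hf1 : Differentiable ℝ f := hf.differentiable (by norm_num)
  have hg1 : Differentiable ℝ g := hg.differentiable (by norm_num)
  have hf2 : ∀ v, Differentiable ℝ (fun y => fderiv ℝ f y v) := fun v =>
    ((hf.fderiv_right (m := 1) (by norm_num)).clm_apply contDiff_const).differentiable
      (by norm_num)
  have hg2 : ∀ v, Differentiable ℝ (fun y => fderiv ℝ g y v) := fun v =>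
    ((hg.fderiv_right (m := 1) (by norm_num)).clm_apply contDiff_const).differentiable
      (by norm_num)
  have h1 : ∀ v q, fderiv ℝ (fun p : E × E => f p.1 * g p.2) q (v, 0) =
      fderiv ℝ f q.1 v * g q.2 := fun v q => by
    simp [fderiv_prod_mul_apply (hf1 _) (hg1 _)]
  have h2 : ∀ v q, fderiv ℝ (fun p : E × E => f p.1 * g p.2) q (0, v) =
      f q.1 * fderiv ℝ g q.2 v := fun v q => by
    simp [fderiv_prod_mul_apply (hf1 _) (hg1 _)]
  rw [sumSecondDeriv, Fintype.sum_sum_type]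
  simp only [pairDirections, Sum.elim_inl, Sum.elim_inr, h1, h2]
  simp only [fderiv_prod_mul_apply (hf2 _ _) (hg1 _), fderiv_prod_mul_apply (hf1 _) (hg2 _ _)]
  simp [sumSecondDeriv, Finset.sum_mul, Finset.mul_sum]

end Tensor

section Slices

variable {Y Z : Type*} [NormedAddCommGroup Y] [NormedSpace ℝ Y] [NormedAddCommGroup Z]
  [NormedSpace ℝ Z] {f : Y × Z → ℂ}

theorem fderiv_slice_left (hf : Differentiable ℝ f) (y v : Y) (z : Z) :
    fderiv ℝ (fun y' => f (y', z)) y v = fderiv ℝ f (y, z) (v, 0) := by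
  have h := HasFDerivAt.comp y (hf (y, z)).hasFDerivAt (hasFDerivAt_prodMk_left (𝕜 := ℝ) y z)
  change HasFDerivAt (fun y' => f (y', z)) _ y at h
  rw [h.fderiv]
  simp

theorem fderiv_slice_right (hf : Differentiable ℝ f) (y : Y) (z v : Z) :
    fderiv ℝ (fun z' => f (y, z')) z v = fderiv ℝ f (y, z) (0, v) := by
  have h := HasFDerivAt.comp z (hf (y, z)).hasFDerivAt (hasFDerivAt_prodMk_right (𝕜 := ℝ) y z)
  change HasFDerivAt (fun z' => f (y, z')) _ z at h
  rw [h.fderiv]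
  simp

end Slices

section Coordinates

variable {k : ℕ} {T : ℝ} {u : ℝ → EuclideanSpace ℝ (Fin 3) → EuclideanSpace ℝ (Fin k) → ℂ}

/-- The coordinate directions of `ℝ³ × ℝᵏ`. -/
def coordDirections (k : ℕ) :
    Fin 3 ⊕ Fin k → EuclideanSpace ℝ (Fin 3) × EuclideanSpace ℝ (Fin k) :=
  Sum.elim (fun i => (EuclideanSpace.single i 1, 0)) (fun j => (0, EuclideanSpace.single j 1))

theorem smoothUniformSchwartzYZ.uniformlySchwartz (hu : smoothUniformSchwartzYZ k T u) :
    UniformlySchwartz (Set.Icc 0 T)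
      (fun t (q : EuclideanSpace ℝ (Fin 3) × EuclideanSpace ℝ (Fin k)) => u t q.1 q.2) := by
  refine ⟨fun t ht => contDiffOn_univ.1 ?_, fun n m => ?_⟩
  · exact hu.1.comp (s := Set.univ) (f := fun q => (t, q))
      (contDiff_prodMk_right t).contDiffOn fun q _ => ⟨ht, trivial⟩
  · obtain ⟨C, hC⟩ := hu.2 n m
    refine ⟨C, fun t ht x => le_trans ?_ (hC t ht x.1 x.2)⟩
    have hx : ‖x‖ ≤ ‖x.1‖ + ‖x.2‖ := max_le (by simp) (by simp)
    rw [add_assoc]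
    gcongr

theorem smoothUniformSchwartzYZ.contDiffOn_Ioo (hu : smoothUniformSchwartzYZ k T u) :
    ContDiffOn ℝ (⊤ : ℕ∞)
      (fun p : ℝ × EuclideanSpace ℝ (Fin 3) × EuclideanSpace ℝ (Fin k) => u p.1 p.2.1 p.2.2)
      (Set.Ioo 0 T ×ˢ Set.univ) :=
  hu.1.mono (Set.prod_mono_left Set.Ioo_subset_Icc_self)

theorem isFreeSchrodingerYZ.deriv_eq (h : isFreeSchrodingerYZ k T u)
    (hu : smoothUniformSchwartzYZ k T u) {t : ℝ} (ht : t ∈ Set.Icc 0 T)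
    (x : EuclideanSpace ℝ (Fin 3) × EuclideanSpace ℝ (Fin k)) :
    deriv (fun s => u s x.1 x.2) t =
      Complex.I * sumSecondDeriv (coordDirections k) (fun q => u t q.1 q.2) x := by
  have hS := hu.uniformlySchwartz
  have h1 := h t ht x.1 x.2
  have hd := hS.differentiable ht
  have hd' := fun v => (hS.fderiv_apply v).differentiable ht
  simp only [fderiv_slice_left hd, fderiv_slice_right hd] at h1
  simp only [fderiv_slice_left (hd' _), fderiv_slice_right (hd' _)] at h1
  rw [add_assoc] at h1
  have h2 : sumSecondDeriv (coordDirections k) (fun q => u t q.1 q.2) x = _ :=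
    Fintype.sum_sum_type _
  simp only [coordDirections, Sum.elim_inl, Sum.elim_inr] at h2
  rw [Prod.mk.eta] at h1
  rw [coordDirections, h2]
  linear_combination (-Complex.I) * h1 + deriv (fun s => u s x.1 x.2) t * Complex.I_sq

theorem isFreeSchrodingerYZ.deriv_mul_eq (h : isFreeSchrodingerYZ k T u)
    (hu : smoothUniformSchwartzYZ k T u) {t : ℝ} (ht : t ∈ Set.Ioo 0 T)
    (p : (EuclideanSpace ℝ (Fin 3) × EuclideanSpace ℝ (Fin k)) ×
      (EuclideanSpace ℝ (Fin 3) × EuclideanSpace ℝ (Fin k))) :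
    deriv (fun s => u s p.1.1 p.1.2 * u s p.2.1 p.2.2) t =
      Complex.I * sumSecondDeriv (pairDirections (coordDirections k))
        (fun p => u t p.1.1 p.1.2 * u t p.2.1 p.2.2) p := by
  have hS := hu.uniformlySchwartz
  have ht' := Set.Ioo_subset_Icc_self ht
  have hd : ∀ x : EuclideanSpace ℝ (Fin 3) × EuclideanSpace ℝ (Fin k),
      DifferentiableAt ℝ (fun s => u s x.1 x.2) t := fun x => by
    have h1 := (hu.contDiffOn_Ioo.contDiffAt
      ((isOpen_Ioo.prod isOpen_univ).mem_nhds ⟨ht, trivial⟩ : _ ∈ nhds (t, x))).differentiableAt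
      (by simp)
    exact DifferentiableAt.comp t h1 (hasFDerivAt_prodMk_left (𝕜 := ℝ) t x).differentiableAt
  have h2 : ContDiff ℝ 2 (fun q : EuclideanSpace ℝ (Fin 3) × EuclideanSpace ℝ (Fin k) =>
      u t q.1 q.2) := contDiff_infty.1 (hS.1 t ht') 2
  rw [deriv_fun_mul (hd p.1) (hd p.2), h.deriv_eq hu ht', h.deriv_eq hu ht',
    sumSecondDeriv_prod_mul _ h2 h2]
  ring

theorem contDiffOn_mul_of_contDiffOn {E : Type*} [NormedAddCommGroup E] [NormedSpace ℝ E]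
    {S : Set ℝ} {w : ℝ → E → ℂ}
    (hw : ContDiffOn ℝ (⊤ : ℕ∞) (fun p : ℝ × E => w p.1 p.2) (S ×ˢ Set.univ)) :
    ContDiffOn ℝ (⊤ : ℕ∞) (fun p : ℝ × E × E => w p.1 p.2.1 * w p.1 p.2.2) (S ×ˢ Set.univ) :=
  (hw.comp (f := fun p : ℝ × E × E => (p.1, p.2.1))
    (contDiff_fst.prodMk (contDiff_fst.comp contDiff_snd)).contDiffOn
    fun _ hp => ⟨hp.1, trivial⟩).mul
  (hw.comp (f := fun p : ℝ × E × E => (p.1, p.2.2))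
    (contDiff_fst.prodMk (contDiff_snd.comp contDiff_snd)).contDiffOn
    fun _ hp => ⟨hp.1, trivial⟩)

/-- The separation `y - y'` of two points `(y, z)` and `(y', z')`. -/
def separation (Y Z : Type*) [NormedAddCommGroup Y] [NormedSpace ℝ Y] [NormedAddCommGroup Z]
    [NormedSpace ℝ Z] : (Y × Z) × (Y × Z) →L[ℝ] Y :=
  (ContinuousLinearMap.fst ℝ Y Z).comp (.fst ℝ _ _) -
    (ContinuousLinearMap.fst ℝ Y Z).comp (.snd ℝ _ _)

@[simp]
theorem separation_apply {Y Z : Type*} [NormedAddCommGroup Y] [NormedSpace ℝ Y]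
    [NormedAddCommGroup Z] [NormedSpace ℝ Z] (p : (Y × Z) × (Y × Z)) :
    separation Y Z p = p.1.1 - p.2.1 := rfl

theorem isMorawetzWeight_separation (k : ℕ) {ε : ℝ} (hε : 0 < ε) :
    IsMorawetzWeight (pairDirections (coordDirections k)) (ε ^ 2)
      (invRegNorm (separation _ _) hε) (fun j => regNormDeriv (separation _ _) hε
        (pairDirections (coordDirections k) j))
      (fun a j => inner ℝ (separation _ _ (pairDirections (coordDirections k) a))
        (separation _ _ (pairDirections (coordDirections k) j))) := by
  refine isMorawetzWeight _ hε (fun w => ?_) ?_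
  · simp [pairDirections, coordDirections, EuclideanSpace.inner_single_right,
      EuclideanSpace.norm_sq_eq, two_mul]
  · simp [pairDirections, coordDirections]
    norm_num

end Coordinates

instance isAddHaarMeasure_prod_self {E : Type*} [NormedAddCommGroup E] [NormedSpace ℝ E]
    [FiniteDimensional ℝ E] [MeasurableSpace E] [BorelSpace E] (μ : Measure E)
    [μ.IsAddHaarMeasure] : (μ.prod μ).IsAddHaarMeasure :=
  Measure.prod.instIsAddHaarMeasure μ μ

/-- The marginal density `∫ |f(y, z)|² dz`. -/
def marginalDensity {Y Z : Type*} [MeasurableSpace Z] (ν : Measure Z) (f : Y × Z → ℂ) (y : Y) : ℝ :=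
  ∫ z, ‖f (y, z)‖ ^ 2 ∂ν

theorem marginalDensity_nonneg {Y Z : Type*} [MeasurableSpace Z] {ν : Measure Z} (f : Y × Z → ℂ)
    (y : Y) : 0 ≤ marginalDensity ν f y :=
  integral_nonneg fun _ => by positivity

section Slices

variable {Y Z : Type*} [NormedAddCommGroup Y] [NormedSpace ℝ Y] [NormedAddCommGroup Z]
  [NormedSpace ℝ Z] {S : Set ℝ} {w : ℝ → Y × Z → ℂ}

theorem UniformlySchwartz.exists_slice_norm_le (hw : UniformlySchwartz S w) (n : ℕ) :
    ∃ C : ℝ, 0 ≤ C ∧ ∀ t ∈ S, ∀ y z, ‖w t (y, z)‖ ≤ C * (1 + ‖z‖) ^ (-(n : ℝ)) := by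
  obtain ⟨C, hC0, hC⟩ := hw.exists_norm_le n
  refine ⟨C, hC0, fun t ht y z => (hC t ht (y, z)).trans ?_⟩
  have : ‖z‖ ≤ ‖(y, z)‖ := le_max_right _ _
  exact mul_le_mul_of_nonneg_left (Real.rpow_le_rpow_of_nonpos (by positivity) (by linarith)
    (by simp)) hC0

theorem UniformlySchwartz.exists_norm_sq_slice_le (hw : UniformlySchwartz S w) (n : ℕ) :
    ∃ C : ℝ, 0 ≤ C ∧ ∀ t ∈ S, ∀ y z, ‖w t (y, z)‖ ^ 2 ≤ C * (1 + ‖z‖) ^ (-(n : ℝ)) := by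
  obtain ⟨C, hC0, hC⟩ := hw.exists_slice_norm_le n
  obtain ⟨D, hD0, hD⟩ := hw.exists_slice_norm_le 0
  refine ⟨D * C, by positivity, fun t ht y z => ?_⟩
  have h1 : ‖w t (y, z)‖ ≤ D := by simpa using hD t ht y z
  rw [sq, mul_assoc]
  gcongr
  exact hC t ht y z

variable [FiniteDimensional ℝ Z] [MeasurableSpace Z] [BorelSpace Z] {ν : Measure Z}
  [ν.IsAddHaarMeasure]

theorem UniformlySchwartz.integrable_norm_sq_slice (hw : UniformlySchwartz S w) {t : ℝ}
    (ht : t ∈ S) (y : Y) : Integrable (fun z => ‖w t (y, z)‖ ^ 2) ν := by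
  obtain ⟨C, -, hC⟩ := hw.exists_norm_sq_slice_le (Module.finrank ℝ Z + 1)
  refine ((integrable_one_add_norm (μ := ν) (E := Z) (r := (Module.finrank ℝ Z + 1 : ℕ))
    (by push_cast; linarith)).const_mul C).mono'
    (((hw.continuous ht).comp (by fun_prop : Continuous fun z => (y, z))).norm.pow
      2).aestronglyMeasurable (.of_forall fun z => ?_)
  rw [Real.norm_of_nonneg (by positivity)]
  exact hC t ht y z

theorem UniformlySchwartz.exists_marginalDensity_le (ν : Measure Z) [ν.IsAddHaarMeasure]
    (hw : UniformlySchwartz S w) : ∃ M, ∀ t ∈ S, ∀ y, marginalDensity ν (w t) y ≤ M := by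
  obtain ⟨C, -, hC⟩ := hw.exists_norm_sq_slice_le (Module.finrank ℝ Z + 1)
  exact ⟨_, fun t ht y => integral_mono (hw.integrable_norm_sq_slice ht y)
    ((integrable_one_add_norm (by push_cast; linarith)).const_mul C) fun z => hC t ht y z⟩

theorem UniformlySchwartz.exists_lipschitz_marginalDensity (ν : Measure Z) [ν.IsAddHaarMeasure]
    (hw : UniformlySchwartz S w) : ∃ L, 0 ≤ L ∧ ∀ t ∈ S, ∀ y y',
      |marginalDensity ν (w t) y - marginalDensity ν (w t) y'| ≤ L * ‖y - y'‖ := by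
  obtain ⟨C, hC0, hC⟩ := hw.exists_slice_norm_le (Module.finrank ℝ Z + 1)
  obtain ⟨D, hD⟩ := hw.2 0 1
  have hlip : ∀ t ∈ S, ∀ x x', ‖w t x - w t x'‖ ≤ D * ‖x - x'‖ := fun t ht x x' =>
    (convex_univ : Convex ℝ (Set.univ : Set (Y × Z))).norm_image_sub_le_of_norm_fderiv_le (𝕜 := ℝ)
      (fun x _ => hw.differentiable ht x)
      (fun x _ => by simpa [norm_iteratedFDeriv_one] using hD t ht x)
      (Set.mem_univ x') (Set.mem_univ x)
  have hbound : Integrable (fun z : Z => (1 + ‖z‖) ^ (-((Module.finrank ℝ Z + 1 : ℕ) : ℝ))) ν :=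
    integrable_one_add_norm (by push_cast; linarith)
  have hD0 : 0 ≤ |D| := abs_nonneg D
  refine ⟨|D| * (2 * C) * ∫ z : Z, (1 + ‖z‖) ^ (-((Module.finrank ℝ Z + 1 : ℕ) : ℝ)) ∂ν,
    mul_nonneg (by positivity) (integral_nonneg fun z => by positivity), fun t ht y y' => ?_⟩
  rw [marginalDensity, marginalDensity, ← integral_sub (hw.integrable_norm_sq_slice ht y)
    (hw.integrable_norm_sq_slice ht y'), mul_right_comm, ← integral_const_mul]
  rw [← Real.norm_eq_abs]
  refine norm_integral_le_of_norm_le (hbound.const_mul _) (.of_forall fun z => ?_)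
  have h1 : ‖w t (y, z) - w t (y', z)‖ ≤ |D| * ‖y - y'‖ := by
    refine (hlip t ht _ _).trans ?_
    simp only [Prod.mk_sub_mk, sub_self, Prod.norm_mk, norm_zero, norm_nonneg, sup_of_le_left]
    gcongr
    exact le_abs_self D
  have h2 := abs_norm_sub_norm_le (w t (y, z)) (w t (y', z))
  have h3 := hC t ht y z
  have h4 := hC t ht y' z
  rw [sq_sub_sq, norm_mul, Real.norm_eq_abs, Real.norm_eq_abs, abs_of_nonneg (by positivity)]
  calc _ ≤ (C * (1 + ‖z‖) ^ (-((Module.finrank ℝ Z + 1 : ℕ) : ℝ)) +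
        C * (1 + ‖z‖) ^ (-((Module.finrank ℝ Z + 1 : ℕ) : ℝ))) * (|D| * ‖y - y'‖) := by
        gcongr
        exact h2.trans h1
    _ = _ := by ring

theorem UniformlySchwartz.continuous_marginalDensity (hw : UniformlySchwartz S w) {t : ℝ}
    (ht : t ∈ S) : Continuous (marginalDensity ν (w t)) := by
  obtain ⟨L, hL0, hL⟩ := hw.exists_lipschitz_marginalDensity ν
  refine (LipschitzWith.of_dist_le_mul (K := ⟨L, hL0⟩) fun y y' => ?_).continuous
  rw [Real.dist_eq, dist_eq_norm]
  exact hL t ht y y'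

end Slices

section Density

variable {Y Z : Type*} [NormedAddCommGroup Y] [InnerProductSpace ℝ Y] [FiniteDimensional ℝ Y]
  [MeasurableSpace Y] [BorelSpace Y] [NormedAddCommGroup Z] [NormedSpace ℝ Z]
  [FiniteDimensional ℝ Z] [MeasurableSpace Z] [BorelSpace Z]
  {μ : Measure Y} {ν : Measure Z} [μ.IsAddHaarMeasure] [ν.IsAddHaarMeasure]
  {S : Set ℝ} {w : ℝ → Y × Z → ℂ}

theorem UniformlySchwartz.integrable_norm_sq {V : Type*} [NormedAddCommGroup V]
    [NormedSpace ℝ V] [FiniteDimensional ℝ V] [MeasurableSpace V] [BorelSpace V] {μ : Measure V}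
    [μ.IsAddHaarMeasure] {w : ℝ → V → ℂ} (hw : UniformlySchwartz S w) {t : ℝ} (ht : t ∈ S) :
    Integrable (fun x => ‖w t x‖ ^ 2) μ := by
  simpa only [sq] using hw.integrable_norm_mul_norm hw ht

theorem UniformlySchwartz.integrable_marginalDensity (hw : UniformlySchwartz S w) {t : ℝ}
    (ht : t ∈ S) : Integrable (marginalDensity ν (w t)) μ :=
  (hw.integrable_norm_sq (μ := μ.prod ν) ht).integral_prod_left

theorem UniformlySchwartz.integrable_norm_sq_mul_marginalDensity (hw : UniformlySchwartz S w)
    {t : ℝ} (ht : t ∈ S) :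
    Integrable (fun x => ‖w t x‖ ^ 2 * marginalDensity ν (w t) x.1) (μ.prod ν) := by
  obtain ⟨M, hM⟩ := hw.exists_marginalDensity_le ν
  simp only [mul_comm (‖w t _‖ ^ 2)]
  refine (hw.integrable_norm_sq ht).bdd_mul (c := M)
    ((hw.continuous_marginalDensity ht).comp continuous_fst).aestronglyMeasurable
    (.of_forall fun x => ?_)
  rw [Real.norm_of_nonneg (marginalDensity_nonneg _ _)]
  exact hM t ht _

theorem UniformlySchwartz.integral_norm_sq_mul_marginalDensity (hw : UniformlySchwartz S w)
    {t : ℝ} (ht : t ∈ S) :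
    ∫ x, ‖w t x‖ ^ 2 * marginalDensity ν (w t) x.1 ∂μ.prod ν =
      ∫ y, marginalDensity ν (w t) y ^ 2 ∂μ := by
  rw [integral_prod _ (hw.integrable_norm_sq_mul_marginalDensity ht)]
  simp only [integral_mul_const]
  simp only [sq, marginalDensity]

theorem two_le_mul_invRegNorm_pow {V F : Type*} [NormedAddCommGroup V] [NormedSpace ℝ V]
    [NormedAddCommGroup F] [InnerProductSpace ℝ F] (P : V →L[ℝ] F) {ε : ℝ} (hε : 0 < ε) {x : V}
    (hx : ‖P x‖ ≤ ε) : 2 / ε ^ 3 ≤ 30 * (ε ^ 2) ^ 2 * invRegNorm P hε x ^ 7 := by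
  set s := invRegNorm P hε x
  have hs : 0 < s := invRegNorm_pos P hε x
  have h1 : 1 ≤ 2 * (ε * s) ^ 2 := by
    rw [← invRegNorm_sq_mul P hε x]
    have : ‖P x‖ ^ 2 ≤ ε ^ 2 := by gcongr
    nlinarith [sq_nonneg s]
  set a := ε * s with ha
  have ha0 : 0 < a := by positivity
  have h2 : (7 / 10 : ℝ) ≤ a := by nlinarith
  have h3 : (2 : ℝ) ≤ 30 * a ^ 7 := by
    calc (2 : ℝ) ≤ 30 * (7 / 10) ^ 7 := by norm_num
      _ ≤ 30 * a ^ 7 := by gcongr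
  rw [div_le_iff₀ (by positivity)]
  refine h3.trans_eq ?_
  rw [ha]
  ring

theorem UniformlySchwartz.le_integral_norm_sq_mul (hw : UniformlySchwartz S w) {t : ℝ}
    (ht : t ∈ S) (hY : Module.finrank ℝ Y = 3) {ε : ℝ} (hε : 0 < ε) {L : ℝ}
    (hL : ∀ y y', |marginalDensity ν (w t) y - marginalDensity ν (w t) y'| ≤ L * ‖y - y'‖)
    (hL0 : 0 ≤ L) (x : Y × Z) :
    2 * μ.real (Metric.ball 0 1) * (marginalDensity ν (w t) x.1 - L * ε) ≤
      30 * (ε ^ 2) ^ 2 * ∫ x', invRegNorm (separation Y Z) hε (x, x') ^ 7 * ‖w t x'‖ ^ 2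
        ∂μ.prod ν := by
  set B : Set Y := Metric.closedBall x.1 ε
  have hB : MeasurableSet B := measurableSet_closedBall
  have hm := hw.integrable_norm_sq (μ := μ.prod ν) ht
  have hF : Integrable (fun x' => 30 * (ε ^ 2) ^ 2 *
      (invRegNorm (separation Y Z) hε (x, x') ^ 7 * ‖w t x'‖ ^ 2)) (μ.prod ν) :=
    (hm.bdd_mul (c := ‖invRegNorm (separation Y Z) hε‖ ^ 7)
      (((invRegNorm (separation Y Z) hε).continuous.comp
        (by fun_prop : Continuous fun x' => (x, x'))).pow 7).aestronglyMeasurable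
      (.of_forall fun x' => by
        rw [Pi.pow_apply, norm_pow]
        gcongr
        exact (invRegNorm (separation Y Z) hε).norm_coe_le_norm _)).const_mul _
  have h1 : 2 / ε ^ 3 * ∫ x' in B ×ˢ Set.univ, ‖w t x'‖ ^ 2 ∂μ.prod ν ≤
      30 * (ε ^ 2) ^ 2 * ∫ x', invRegNorm (separation Y Z) hε (x, x') ^ 7 * ‖w t x'‖ ^ 2
        ∂μ.prod ν := by
    rw [← integral_const_mul, ← integral_const_mul]
    refine (setIntegral_mono_on (hm.const_mul _).integrableOn hF.integrableOn
      (hB.prod .univ) fun x' hx' => ?_).trans (setIntegral_le_integral hF (.of_forall fun x' => ?_))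
    · rw [← mul_assoc]
      gcongr
      refine two_le_mul_invRegNorm_pow _ hε ?_
      rw [separation_apply, norm_sub_rev, ← dist_eq_norm]
      exact hx'.1
    · have := invRegNorm_pos (separation Y Z) hε (x, x')
      simp only [Pi.zero_apply]
      positivity
  refine le_trans ?_ h1
  rw [setIntegral_prod _ hm.integrableOn]
  simp only [Measure.restrict_univ]
  have h2 : μ.real B • (marginalDensity ν (w t) x.1 - L * ε) ≤
      ∫ y in B, marginalDensity ν (w t) y ∂μ := by
    refine setIntegral_ge_of_const_le hB measure_closedBall_lt_top.ne (fun y hy => ?_)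
      (hw.integrable_marginalDensity ht).integrableOn
    have h3 := (le_abs_self _).trans (hL x.1 y)
    have h4 : L * ‖x.1 - y‖ ≤ L * ε := by
      gcongr
      rw [norm_sub_rev, ← dist_eq_norm]
      exact hy
    linarith
  rw [Measure.addHaar_real_closedBall _ _ hε.le, hY, smul_eq_mul] at h2
  calc _ = 2 / ε ^ 3 * (ε ^ 3 * μ.real (Metric.ball 0 1) *
        (marginalDensity ν (w t) x.1 - L * ε)) := by field_simp
    _ ≤ _ := by
      gcongr
      exact h2

theorem UniformlySchwartz.le_integral_invRegNorm_pow (hw : UniformlySchwartz S w) {t : ℝ}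
    (ht : t ∈ S) (hY : Module.finrank ℝ Y = 3) {ε : ℝ} (hε : 0 < ε) {L : ℝ} (hL0 : 0 ≤ L)
    (hL : ∀ y y', |marginalDensity ν (w t) y - marginalDensity ν (w t) y'| ≤ L * ‖y - y'‖) :
    2 * μ.real (Metric.ball 0 1) * (∫ y, marginalDensity ν (w t) y ^ 2 ∂μ -
        L * ε * ∫ x, ‖w t x‖ ^ 2 ∂μ.prod ν) ≤
      30 * (ε ^ 2) ^ 2 * ∫ p, invRegNorm (separation Y Z) hε p ^ 7 * ‖w t p.1 * w t p.2‖ ^ 2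
        ∂(μ.prod ν).prod (μ.prod ν) := by
  have hm := hw.integrable_norm_sq (μ := μ.prod ν) ht
  have hF : Integrable (fun p => invRegNorm (separation Y Z) hε p ^ 7 *
      ‖w t p.1 * w t p.2‖ ^ 2) ((μ.prod ν).prod (μ.prod ν)) :=
    ((hw.tensor hw).integrable_norm_sq ht).bdd_mul (c := ‖invRegNorm (separation Y Z) hε‖ ^ 7)
      ((invRegNorm (separation Y Z) hε).continuous.pow 7).aestronglyMeasurable
      (.of_forall fun p => by
        rw [norm_pow]
        gcongr
        exact (invRegNorm (separation Y Z) hε).norm_coe_le_norm _)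
  rw [integral_prod _ hF, ← hw.integral_norm_sq_mul_marginalDensity ht, ← integral_const_mul,
    ← integral_sub (hw.integrable_norm_sq_mul_marginalDensity ht) (hm.const_mul _),
    ← integral_const_mul, ← integral_const_mul]
  refine integral_mono (((hw.integrable_norm_sq_mul_marginalDensity ht).sub
    (hm.const_mul _)).const_mul _) (hF.integral_prod_left.const_mul _) fun x => ?_
  have h1 := mul_le_mul_of_nonneg_left (hw.le_integral_norm_sq_mul (μ := μ) ht hY hε hL hL0 x)
    (sq_nonneg ‖w t x‖)
  have h2 : ∫ x', invRegNorm (separation Y Z) hε (x, x') ^ 7 * ‖w t x * w t x'‖ ^ 2 ∂μ.prod ν =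
      ‖w t x‖ ^ 2 * ∫ x', invRegNorm (separation Y Z) hε (x, x') ^ 7 * ‖w t x'‖ ^ 2
        ∂μ.prod ν := by
    rw [← integral_const_mul]
    congr with x'
    rw [norm_mul]
    ring
  simp only [h2]
  linarith

end Density

theorem abs_sum_mul_inner_le {ι : Type*} [Fintype ι] {c : ι → ℝ} (hc : ∑ i, c i ^ 2 ≤ 1) (a : ℂ)
    (D : ι → ℂ) :
    |∑ i, c i * inner ℝ (Complex.I * a) (D i)| ≤ ‖a‖ * √(∑ i, ‖D i‖ ^ 2) := by
  calc _ ≤ ∑ i, ‖a‖ * (|c i| * ‖D i‖) := by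
        refine (Finset.abs_sum_le_sum_abs _ _).trans (Finset.sum_le_sum fun i _ => ?_)
        have h := abs_real_inner_le_norm (Complex.I * a) (D i)
        rw [norm_mul, Complex.norm_I, one_mul] at h
        rw [abs_mul, mul_left_comm]
        gcongr
    _ ≤ ‖a‖ * (√(∑ i, |c i| ^ 2) * √(∑ i, ‖D i‖ ^ 2)) := by
        rw [← Finset.mul_sum]
        gcongr
        exact Real.sum_mul_le_sqrt_mul_sqrt _ _ _
    _ ≤ ‖a‖ * (1 * √(∑ i, ‖D i‖ ^ 2)) := by
        simp only [sq_abs]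
        gcongr
        exact Real.sqrt_le_one.2 hc
    _ = _ := by rw [one_mul]

section ActionBound

variable {k : ℕ}

/-- The Euclidean norm of the gradient of `f` in the first three coordinates. -/
def partialGradNorm (f : EuclideanSpace ℝ (Fin 3) × EuclideanSpace ℝ (Fin k) → ℂ)
    (x : EuclideanSpace ℝ (Fin 3) × EuclideanSpace ℝ (Fin k)) : ℝ :=
  √(∑ i : Fin 3, ‖fderiv ℝ f x (EuclideanSpace.single i 1, 0)‖ ^ 2)

theorem sum_sq_invRegNorm_mul_inner_le {ε : ℝ} (hε : 0 < ε) (ς : ℝ) (hς : ς ^ 2 = 1)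
    (p : (EuclideanSpace ℝ (Fin 3) × EuclideanSpace ℝ (Fin k)) ×
      (EuclideanSpace ℝ (Fin 3) × EuclideanSpace ℝ (Fin k))) :
    ∑ i : Fin 3, (invRegNorm (separation _ _) hε p * (ς * (p.1.1 i - p.2.1 i))) ^ 2 ≤ 1 := by
  have h1 := invRegNorm_mul_norm_le (separation _ _) hε p
  have h0 := (invRegNorm_pos (separation _ _) hε p).le
  have h2 : ∑ i : Fin 3, (p.1.1 i - p.2.1 i) ^ 2 = ‖separation _ _ p‖ ^ 2 := by
    simp [EuclideanSpace.norm_sq_eq]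
  simp only [mul_pow, hς, one_mul]
  rw [← Finset.mul_sum, h2, ← mul_pow]
  exact pow_le_one₀ (by positivity) h1

theorem abs_sum_regNormDeriv_mul_inner_le {ε : ℝ} (hε : 0 < ε)
    {f : EuclideanSpace ℝ (Fin 3) × EuclideanSpace ℝ (Fin k) → ℂ} (hf : Differentiable ℝ f)
    (p : (EuclideanSpace ℝ (Fin 3) × EuclideanSpace ℝ (Fin k)) ×
      (EuclideanSpace ℝ (Fin 3) × EuclideanSpace ℝ (Fin k))) :
    |∑ j, regNormDeriv (separation _ _) hε (pairDirections (coordDirections k) j) p *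
        inner ℝ (Complex.I * (f p.1 * f p.2))
          (fderiv ℝ (fun p => f p.1 * f p.2) p (pairDirections (coordDirections k) j))| ≤
      ‖f p.1‖ * partialGradNorm f p.1 * ‖f p.2‖ ^ 2 +
        ‖f p.1‖ ^ 2 * (‖f p.2‖ * partialGradNorm f p.2) := by
  have h1 := abs_sum_mul_inner_le (sum_sq_invRegNorm_mul_inner_le hε 1 (by norm_num) p)
    (f p.1 * f p.2) (fun i : Fin 3 => fderiv ℝ f p.1 (EuclideanSpace.single i 1, 0) * f p.2)
  have h2 := abs_sum_mul_inner_le (sum_sq_invRegNorm_mul_inner_le hε (-1) (by norm_num) p)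
    (f p.1 * f p.2) (fun i : Fin 3 => f p.1 * fderiv ℝ f p.2 (EuclideanSpace.single i 1, 0))
  simp only [norm_mul, mul_pow] at h1 h2
  rw [← Finset.sum_mul, Real.sqrt_mul' _ (by positivity), Real.sqrt_sq (by positivity)] at h1
  rw [← Finset.mul_sum, Real.sqrt_mul (by positivity), Real.sqrt_sq (by positivity)] at h2
  rw [Fintype.sum_sum_type, Fintype.sum_sum_type, Fintype.sum_sum_type]
  simp only [pairDirections, coordDirections, Sum.elim_inl, Sum.elim_inr, regNormDeriv_apply,
    fderiv_prod_mul_apply (hf _) (hf _)]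
  have h3 : ∀ (v : EuclideanSpace ℝ (Fin 3)) (i : Fin 3),
      inner ℝ v (EuclideanSpace.single i 1) = v i := fun v i => by
    simp [EuclideanSpace.inner_single_right]
  simp only [separation_apply, Prod.fst_zero, sub_zero, zero_sub, inner_neg_right,
    inner_zero_right, mul_zero, zero_mul, add_zero, zero_add, Finset.sum_const_zero,
    map_zero, h3, PiLp.sub_apply]
  simp only [one_mul, neg_one_mul] at h1 h2
  refine (abs_add_le _ _).trans (add_le_add (h1.trans_eq ?_) (h2.trans_eq ?_)) <;>
  · rw [partialGradNorm]
    ring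

variable {S : Set ℝ} {w : ℝ → EuclideanSpace ℝ (Fin 3) × EuclideanSpace ℝ (Fin k) → ℂ}

theorem partialGradNorm_nonneg (f : EuclideanSpace ℝ (Fin 3) × EuclideanSpace ℝ (Fin k) → ℂ)
    (x : EuclideanSpace ℝ (Fin 3) × EuclideanSpace ℝ (Fin k)) : 0 ≤ partialGradNorm f x :=
  Real.sqrt_nonneg _

theorem UniformlySchwartz.continuous_partialGradNorm (hw : UniformlySchwartz S w) {t : ℝ}
    (ht : t ∈ S) : Continuous (partialGradNorm (w t)) :=
  (continuous_finsetSum _ fun _ _ => ((hw.fderiv_apply _).continuous ht).norm.pow 2).sqrt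

theorem UniformlySchwartz.exists_norm_mul_partialGradNorm_le (hw : UniformlySchwartz S w) (n : ℕ) :
    ∃ C : ℝ, ∀ t ∈ S, ∀ x, ‖w t x‖ * partialGradNorm (w t) x ≤ C * (1 + ‖x‖) ^ (-(n : ℝ)) := by
  choose C hC0 hC using fun i : Fin 3 =>
    hw.exists_norm_mul_norm_le (hw.fderiv_apply (EuclideanSpace.single i 1, 0)) n
  refine ⟨∑ i, C i, fun t ht x => ?_⟩
  have h : partialGradNorm (w t) x ≤
      ∑ i : Fin 3, ‖fderiv ℝ (w t) x (EuclideanSpace.single i 1, 0)‖ :=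
    (Real.sqrt_le_left (by positivity)).2
      (Finset.sum_sq_le_sq_sum_of_nonneg fun i _ => norm_nonneg _)
  rw [Finset.sum_mul]
  refine (mul_le_mul_of_nonneg_left h (norm_nonneg _)).trans ?_
  rw [Finset.mul_sum]
  exact Finset.sum_le_sum fun i _ => hC i t ht x

theorem UniformlySchwartz.integrable_norm_mul_partialGradNorm (hw : UniformlySchwartz S w) {t : ℝ}
    (ht : t ∈ S) {μ : Measure (EuclideanSpace ℝ (Fin 3) × EuclideanSpace ℝ (Fin k))}
    [μ.IsAddHaarMeasure] : Integrable (fun x => ‖w t x‖ * partialGradNorm (w t) x) μ := by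
  obtain ⟨C, hC⟩ := hw.exists_norm_mul_partialGradNorm_le
    (Module.finrank ℝ (EuclideanSpace ℝ (Fin 3) × EuclideanSpace ℝ (Fin k)) + 1)
  refine ((integrable_one_add_norm (μ := μ) (lt_add_one _)).const_mul C).mono'
    ((hw.continuous ht).norm.mul (hw.continuous_partialGradNorm ht)).aestronglyMeasurable
    (.of_forall fun x => ?_)
  rw [Real.norm_of_nonneg (mul_nonneg (norm_nonneg _) (partialGradNorm_nonneg _ _))]
  exact_mod_cast hC t ht x

theorem UniformlySchwartz.exists_integral_norm_sq_le (hw : UniformlySchwartz S w)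
    (μ : Measure (EuclideanSpace ℝ (Fin 3) × EuclideanSpace ℝ (Fin k))) [μ.IsAddHaarMeasure] :
    ∃ M, ∀ t ∈ S, ∫ x, ‖w t x‖ ^ 2 ∂μ ≤ M := by
  obtain ⟨C, -, hC⟩ := hw.exists_norm_mul_norm_le hw
    (Module.finrank ℝ (EuclideanSpace ℝ (Fin 3) × EuclideanSpace ℝ (Fin k)) + 1)
  refine ⟨_, fun t ht => integral_mono (hw.integrable_norm_sq ht)
    ((integrable_one_add_norm (lt_add_one _)).const_mul C) fun x => ?_⟩
  rw [sq]
  exact_mod_cast hC t ht x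

theorem UniformlySchwartz.exists_integral_norm_mul_partialGradNorm_le
    (hw : UniformlySchwartz S w)
    (μ : Measure (EuclideanSpace ℝ (Fin 3) × EuclideanSpace ℝ (Fin k))) [μ.IsAddHaarMeasure] :
    ∃ M, ∀ t ∈ S, ∫ x, ‖w t x‖ * partialGradNorm (w t) x ∂μ ≤ M := by
  obtain ⟨C, hC⟩ := hw.exists_norm_mul_partialGradNorm_le
    (Module.finrank ℝ (EuclideanSpace ℝ (Fin 3) × EuclideanSpace ℝ (Fin k)) + 1)
  refine ⟨_, fun t ht => integral_mono (hw.integrable_norm_mul_partialGradNorm ht)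
    ((integrable_one_add_norm (lt_add_one _)).const_mul C) fun x => ?_⟩
  exact_mod_cast hC t ht x

/-- The interaction Morawetz action is controlled by mass times momentum. -/
theorem UniformlySchwartz.abs_morawetzAction_le (hw : UniformlySchwartz S w) {t : ℝ} (ht : t ∈ S)
    (μ : Measure (EuclideanSpace ℝ (Fin 3) × EuclideanSpace ℝ (Fin k))) [μ.IsAddHaarMeasure]
    {ε : ℝ} (hε : 0 < ε) :
    |morawetzAction (μ.prod μ) (pairDirections (coordDirections k))
        (fun j => regNormDeriv (separation _ _) hε (pairDirections (coordDirections k) j))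
        (fun p => w t p.1 * w t p.2)| ≤
      2 * ((∫ x, ‖w t x‖ ^ 2 ∂μ) * ∫ x, ‖w t x‖ * partialGradNorm (w t) x ∂μ) := by
  have h1 := hw.integrable_norm_sq (μ := μ) ht
  have h2 := hw.integrable_norm_mul_partialGradNorm (μ := μ) ht
  have h : ∫ p, (‖w t p.1‖ * partialGradNorm (w t) p.1 * ‖w t p.2‖ ^ 2 +
      ‖w t p.1‖ ^ 2 * (‖w t p.2‖ * partialGradNorm (w t) p.2)) ∂μ.prod μ =
      2 * ((∫ x, ‖w t x‖ ^ 2 ∂μ) * ∫ x, ‖w t x‖ * partialGradNorm (w t) x ∂μ) := by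
    rw [integral_add (h2.mul_prod h1) (h1.mul_prod h2),
      integral_prod_mul (fun x => ‖w t x‖ * partialGradNorm (w t) x) (fun x => ‖w t x‖ ^ 2),
      integral_prod_mul (fun x => ‖w t x‖ ^ 2) (fun x => ‖w t x‖ * partialGradNorm (w t) x)]
    ring
  rw [← h, morawetzAction, ← Real.norm_eq_abs]
  exact norm_integral_le_of_norm_le ((h2.mul_prod h1).add (h1.mul_prod h2))
    (.of_forall fun p => abs_sum_regNormDeriv_mul_inner_le hε (hw.differentiable ht) p)

end ActionBound

section FreeSchrodinger

variable {k : ℕ} {T : ℝ} {u : ℝ → EuclideanSpace ℝ (Fin 3) → EuclideanSpace ℝ (Fin k) → ℂ}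
  {M P : ℝ}

theorem isFreeSchrodingerYZ.intervalIntegral_le (h : isFreeSchrodingerYZ k T u)
    (hu : smoothUniformSchwartzYZ k T u)
    (hM : ∀ t ∈ Set.Ioo 0 T, ∫ x : EuclideanSpace ℝ (Fin 3) × EuclideanSpace ℝ (Fin k),
      ‖u t x.1 x.2‖ ^ 2 ∂volume.prod volume ≤ M)
    (hP : ∀ t ∈ Set.Ioo 0 T, ∫ x : EuclideanSpace ℝ (Fin 3) × EuclideanSpace ℝ (Fin k),
      ‖u t x.1 x.2‖ * partialGradNorm (fun q => u t q.1 q.2) x ∂volume.prod volume ≤ P)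
    (hM0 : 0 ≤ M) {a b : ℝ} (hab : a ≤ b) (hI : Set.Icc a b ⊆ Set.Ioo 0 T)
    (hint : IntegrableOn (fun t => ∫ y : EuclideanSpace ℝ (Fin 3),
      (∫ z, ‖u t y z‖ ^ 2) ^ 2) (Set.Icc a b)) :
    volume.real (Metric.ball (0 : EuclideanSpace ℝ (Fin 3)) 1) *
      ∫ t in a..b, ∫ y, (∫ z, ‖u t y z‖ ^ 2) ^ 2 ≤ 2 * (M * P) := by
  set v := volume.real (Metric.ball (0 : EuclideanSpace ℝ (Fin 3)) 1)
  set g : ℝ → ℝ := fun t => ∫ y, (∫ z, ‖u t y z‖ ^ 2) ^ 2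
  have hv : 0 ≤ v := measureReal_nonneg
  have hw := hu.uniformlySchwartz.mono Set.Ioo_subset_Icc_self
  obtain ⟨L, hL0, hL⟩ := hw.exists_lipschitz_marginalDensity volume
  have hε : ∀ ε : ℝ, 0 < ε → v * ∫ t in a..b, g t ≤ 2 * (M * P) + v * (L * M * (b - a)) * ε := by
    intro ε hε
    have hB : ∀ t ∈ Set.Ioo 0 T, _ ≤ 2 * (M * P) := fun t ht =>
      (hw.abs_morawetzAction_le ht (volume.prod volume) hε).trans
        (mul_le_mul_of_nonneg_left (mul_le_mul (hM t ht) (hP t ht)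
          (integral_nonneg fun x => mul_nonneg (norm_nonneg _) (partialGradNorm_nonneg _ _)) hM0)
          zero_le_two)
    have hφ : ∀ t ∈ Set.Ioo 0 T, 2 * v * (g t - L * ε * M) ≤ _ := fun t ht =>
      le_trans (mul_le_mul_of_nonneg_left (sub_le_sub_left
        (mul_le_mul_of_nonneg_left (hM t ht) (by positivity)) _) (by positivity))
        (hw.le_integral_invRegNorm_pow (μ := volume) (ν := volume) ht (by simp) hε hL0 (hL t ht))
    have hci : IntegrableOn (fun _ : ℝ => L * ε * M) (Set.Icc a b) :=
      integrableOn_const (by simp)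
    have hμ : ((volume.prod volume).prod (volume.prod volume) :
        Measure ((EuclideanSpace ℝ (Fin 3) × EuclideanSpace ℝ (Fin k)) ×
          (EuclideanSpace ℝ (Fin 3) × EuclideanSpace ℝ (Fin k)))).IsAddHaarMeasure :=
      isAddHaarMeasure_prod_self (volume.prod volume)
    have key := (isMorawetzWeight_separation k hε).integral_le isOpen_Ioo (hw.tensor hw)
      (contDiffOn_mul_of_contDiffOn (E := EuclideanSpace ℝ (Fin 3) × EuclideanSpace ℝ (Fin k))
        (w := fun t q => u t q.1 q.2) hu.contDiffOn_Ioo) (fun t ht => h.deriv_mul_eq hu ht) hB hφ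
      hab hI ((hint.sub hci).const_mul _)
    rw [intervalIntegral.integral_const_mul, intervalIntegral.integral_sub
      ((intervalIntegrable_iff_integrableOn_Icc_of_le hab).2 hint) intervalIntegrable_const,
      intervalIntegral.integral_const, smul_eq_mul] at key
    linarith
  refine le_of_forall_pos_le_add fun δ hδ => ?_
  have hK : 0 ≤ v * (L * M * (b - a)) := by
    have := sub_nonneg.2 hab
    positivity
  refine (hε (δ / (v * (L * M * (b - a)) + 1)) (by positivity)).trans ?_
  gcongr
  rw [mul_div_assoc', div_le_iff₀ (by positivity)]
  linarith

theorem isFreeSchrodingerYZ.setIntegral_le (h : isFreeSchrodingerYZ k T u)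
    (hu : smoothUniformSchwartzYZ k T u) (hT : 0 < T)
    (hM : ∀ t ∈ Set.Ioo 0 T, ∫ x : EuclideanSpace ℝ (Fin 3) × EuclideanSpace ℝ (Fin k),
      ‖u t x.1 x.2‖ ^ 2 ∂volume.prod volume ≤ M)
    (hP : ∀ t ∈ Set.Ioo 0 T, ∫ x : EuclideanSpace ℝ (Fin 3) × EuclideanSpace ℝ (Fin k),
      ‖u t x.1 x.2‖ * partialGradNorm (fun q => u t q.1 q.2) x ∂volume.prod volume ≤ P)
    (hM0 : 0 ≤ M) (hP0 : 0 ≤ P) :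
    volume.real (Metric.ball (0 : EuclideanSpace ℝ (Fin 3)) 1) *
      ∫ t in Set.Icc 0 T, ∫ y, (∫ z, ‖u t y z‖ ^ 2) ^ 2 ≤ 2 * (M * P) := by
  by_cases hint : IntegrableOn (fun t => ∫ y : EuclideanSpace ℝ (Fin 3),
      (∫ z, ‖u t y z‖ ^ 2) ^ 2) (Set.Icc 0 T)
  swap
  · rw [integral_undef hint]
    simp only [mul_zero]
    positivity
  have ha : Filter.Tendsto (fun δ : ℝ => δ) (nhdsWithin 0 (Set.Ioi 0)) (nhds 0) :=
    nhdsWithin_le_nhds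
  have hb : Filter.Tendsto (fun δ : ℝ => T - δ) (nhdsWithin 0 (Set.Ioi 0)) (nhds T) := by
    simpa using ha.const_sub T
  have hlim := (aecover_Ioo_of_Icc (μ := volume) ha hb).integral_tendsto_of_countably_generated
    (hint.mono_set Set.Ioo_subset_Icc_self)
  rw [integral_Icc_eq_integral_Ioo]
  refine le_of_tendsto (hlim.const_mul _) ?_
  filter_upwards [Ioo_mem_nhdsGT (half_pos hT)] with δ hδ
  have hI : Set.Icc δ (T - δ) ⊆ Set.Ioo 0 T := fun t ht =>
    ⟨hδ.1.trans_le ht.1, ht.2.trans_lt (sub_lt_self T hδ.1)⟩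
  have hab : δ ≤ T - δ := by linarith [hδ.2]
  rw [Measure.restrict_restrict_of_subset hI, integral_Icc_eq_integral_Ioc,
    ← intervalIntegral.integral_of_le hab]
  exact h.intervalIntegral_le hu hM hP hM0 hab hI
    (hint.mono_set (hI.trans Set.Ioo_subset_Icc_self))

theorem smoothUniformSchwartzYZ.integral_norm_sq_eq (hu : smoothUniformSchwartzYZ k T u) {t : ℝ}
    (ht : t ∈ Set.Icc 0 T) :
    ∫ x : EuclideanSpace ℝ (Fin 3) × EuclideanSpace ℝ (Fin k),
      ‖u t x.1 x.2‖ ^ 2 ∂volume.prod volume = ∫ y, ∫ z, ‖u t y z‖ ^ 2 :=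
  integral_prod _ (hu.uniformlySchwartz.integrable_norm_sq ht)

theorem smoothUniformSchwartzYZ.integral_norm_mul_partialGradNorm_eq
    (hu : smoothUniformSchwartzYZ k T u) {t : ℝ} (ht : t ∈ Set.Icc 0 T) :
    ∫ x : EuclideanSpace ℝ (Fin 3) × EuclideanSpace ℝ (Fin k),
      ‖u t x.1 x.2‖ * partialGradNorm (fun q => u t q.1 q.2) x ∂volume.prod volume =
    ∫ y, ∫ z, ‖u t y z‖ * √(∑ i : Fin 3,
      ‖fderiv ℝ (fun y' => u t y' z) y (EuclideanSpace.single i 1)‖ ^ 2) := by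
  rw [integral_prod _ (hu.uniformlySchwartz.integrable_norm_mul_partialGradNorm ht)]
  simp only [partialGradNorm, fderiv_slice_left (hu.uniformlySchwartz.differentiable ht)]

end FreeSchrodinger

/-- **Interaction Morawetz estimate for the free Schrödinger equation.** There is an
absolute constant `C > 0` such that for `d ≥ 4`, every `T > 0` and every smooth,
uniformly-Schwartz solution of `i∂ₜu + Δu = 0` on `[0,T] × ℝ^d` (with `x = (y,z) ∈
ℝ³ × ℝ^{d-3}`):
`∫₀ᵀ∫_{ℝ³} (∫|u|²dz)² dy dt ≤ C (sup_t ‖u(t)‖²_{L²}) (sup_t ∫ |u| |∇_y u| dx)`. -/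
theorem stmt_10 :
    ∃ C : ℝ, 0 < C ∧
    ∀ k : ℕ, 1 ≤ k → ∀ T : ℝ, 0 < T →
    ∀ u : ℝ → EuclideanSpace ℝ (Fin 3) → EuclideanSpace ℝ (Fin k) → ℂ,
    smoothUniformSchwartzYZ k T u → isFreeSchrodingerYZ k T u →
    (∫ t in Set.Icc (0 : ℝ) T, ∫ y : EuclideanSpace ℝ (Fin 3),
        (∫ z : EuclideanSpace ℝ (Fin k), ‖u t y z‖ ^ 2) ^ 2)
      ≤ C *
        (⨆ t : Set.Icc (0 : ℝ) T, ∫ y : EuclideanSpace ℝ (Fin 3),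
          ∫ z : EuclideanSpace ℝ (Fin k), ‖u t.1 y z‖ ^ 2) *
        (⨆ t : Set.Icc (0 : ℝ) T, ∫ y : EuclideanSpace ℝ (Fin 3),
          ∫ z : EuclideanSpace ℝ (Fin k), ‖u t.1 y z‖ *
            Real.sqrt (∑ i : Fin 3,
              ‖fderiv ℝ (fun y' => u t.1 y' z) y (EuclideanSpace.single i 1)‖ ^ 2)) := by
  have hv : 0 < volume.real (Metric.ball (0 : EuclideanSpace ℝ (Fin 3)) 1) :=
    ENNReal.toReal_pos (Metric.measure_ball_pos _ _ one_pos).ne' measure_ball_lt_top.ne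
  refine ⟨2 / volume.real (Metric.ball (0 : EuclideanSpace ℝ (Fin 3)) 1), by positivity,
    fun k _ T hT u hu h => ?_⟩
  obtain ⟨M, hM⟩ := hu.uniformlySchwartz.exists_integral_norm_sq_le (volume.prod volume)
  obtain ⟨P, hP⟩ :=
    hu.uniformlySchwartz.exists_integral_norm_mul_partialGradNorm_le (volume.prod volume)
  have hmass : BddAbove (Set.range fun t : Set.Icc (0 : ℝ) T =>
      ∫ y, ∫ z, ‖u t.1 y z‖ ^ 2) := by
    refine ⟨M, ?_⟩
    rintro _ ⟨t, rfl⟩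
    exact (hu.integral_norm_sq_eq t.2).symm.trans_le (hM t.1 t.2)
  have hmom : BddAbove (Set.range fun t : Set.Icc (0 : ℝ) T => ∫ y, ∫ z, ‖u t.1 y z‖ *
      √(∑ i : Fin 3, ‖fderiv ℝ (fun y' => u t.1 y' z) y (EuclideanSpace.single i 1)‖ ^ 2)) := by
    refine ⟨P, ?_⟩
    rintro _ ⟨t, rfl⟩
    exact (hu.integral_norm_mul_partialGradNorm_eq t.2).symm.trans_le (hP t.1 t.2)
  have key := h.setIntegral_le hu hT
    (fun t ht => (hu.integral_norm_sq_eq (Set.Ioo_subset_Icc_self ht)).trans_le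
      (le_ciSup hmass ⟨t, Set.Ioo_subset_Icc_self ht⟩))
    (fun t ht => (hu.integral_norm_mul_partialGradNorm_eq (Set.Ioo_subset_Icc_self ht)).trans_le
      (le_ciSup hmom ⟨t, Set.Ioo_subset_Icc_self ht⟩))
    (Real.iSup_nonneg fun t => integral_nonneg fun y => integral_nonneg fun z => by positivity)
    (Real.iSup_nonneg fun t => integral_nonneg fun y => integral_nonneg fun z => by positivity)
  rw [mul_comm, ← le_div_iff₀ hv] at key
  exact key.trans_eq (by ring)

end
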